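/- arXiv:1504.06683 — 2 statements merged into one kernel-verified Lean document; each statement's English description precedes it below -/
import Mathlib

section
/- In the stated two-period setting, the value functions satisfy φ̃(u) = 1 + (1/2)E[u²] and φ(u) = (1/2)E[u²] for every u ∈ L². Consequently φ̃* ≠ φ* (indeed φ̃*(y) = (1/2)E[y²] − 1 and φ*(y) = (1/2)E[y²] for all y ∈ L²). -/
open MeasureTheory
open scoped ENNReal

noncomputable section

/-- The positive part of an extended real number, as an extended nonnegative real. -/
def epos (a : EReal) : ℝ≥0∞ := if a = ⊤ then ⊤ else ENNReal.ofReal a.toReal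

/-- Expectation of an extended-real-valued function: `+∞` unless the positive part is
integrable. -/
def EE {Ω : Type} {mΩ : MeasurableSpace Ω} (P : Measure Ω) (φ : Ω → EReal) : EReal :=
  if ∫⁻ ω, epos (φ ω) ∂P = ⊤ then ⊤
  else ((∫⁻ ω, epos (φ ω) ∂P : ℝ≥0∞) : EReal) - ((∫⁻ ω, epos (-(φ ω)) ∂P : ℝ≥0∞) : EReal)

variable {Ω : Type} {mΩ : MeasurableSpace Ω}

/-- The adapted strategies `x = (x₀,x₁)`: `x₀` a.s. constant (`𝓕₀` is the completed trivial
σ-algebra) and `x₁` `𝓕₁`-measurable. -/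
def Ntwo (P : Measure Ω) (ℱ₁ : MeasurableSpace Ω) : Set ((Ω → ℝ) × (Ω → ℝ)) :=
  {x | (∃ c : ℝ, x.1 =ᵐ[P] fun _ => c) ∧ Measurable[ℱ₁] x.2}

/-- The essentially bounded adapted strategies. -/
def NtwoInf (P : Measure Ω) (ℱ₁ : MeasurableSpace Ω) : Set ((Ω → ℝ) × (Ω → ℝ)) :=
  {x | x ∈ Ntwo P ℱ₁ ∧ ∃ M : ℝ, ∀ᵐ ω ∂P, |x.1 ω| ≤ M ∧ |x.2 ω| ≤ M}

open scoped Classical in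
/-- `f(x,u,ω) = |x₀−1| + (1/2)|u|²` if `α(ω)|x₀| ≤ x₁`, and `+∞` otherwise. -/
def fTwo (α : Ω → ℝ) : ℝ × ℝ → ℝ → Ω → EReal :=
  fun x u ω => if α ω * |x.1| ≤ x.2 then ((|x.1 - 1| + u ^ 2 / 2 : ℝ) : EReal) else ⊤

/-- `Ef(x,u)`. -/
def intFTwo (P : Measure Ω) (α : Ω → ℝ) (x : (Ω → ℝ) × (Ω → ℝ)) (u : Ω → ℝ) : EReal :=
  EE P fun ω => fTwo α (x.1 ω, x.2 ω) (u ω) ω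

/-- `𝓤 = 𝓨 = L²`. -/
def Ltwo (P : Measure Ω) : Set (Ω → ℝ) := {u | MemLp u 2 P}

/-- `φ(u) = inf_{x∈𝓝} Ef(x,u)`. -/
def phiTwo (P : Measure Ω) (ℱ₁ : MeasurableSpace Ω) (α : Ω → ℝ) (u : Ω → ℝ) : EReal :=
  ⨅ x ∈ Ntwo P ℱ₁, intFTwo P α x u

/-- `φ̃(u) = inf_{x∈𝓝^∞} Ef(x,u)`. -/
def phiTwoTilde (P : Measure Ω) (ℱ₁ : MeasurableSpace Ω) (α : Ω → ℝ) (u : Ω → ℝ) : EReal :=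
  ⨅ x ∈ NtwoInf P ℱ₁, intFTwo P α x u

/-- Conjugate with respect to the pairing of `L²` with itself. -/
def conjTwo (P : Measure Ω) (g : (Ω → ℝ) → EReal) (y : Ω → ℝ) : EReal :=
  ⨆ u ∈ Ltwo P, (((∫ ω, u ω * y ω ∂P : ℝ) : EReal) - g u)

lemma aux_ae (P : Measure Ω) [IsProbabilityMeasure P] (α : Ω → ℝ)
    (x : (Ω → ℝ) × (Ω → ℝ)) (u : Ω → ℝ) (hu : MemLp u 2 P) (c : ℝ)
    (hc : x.1 =ᵐ[P] fun _ => c) (hf : ∀ᵐ ω ∂P, α ω * |c| ≤ x.2 ω) :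
    intFTwo P α x u = ((|c - 1| + (∫ ω, (u ω) ^ 2 ∂P) / 2 : ℝ) : EReal) := by
  have hint : Integrable (fun ω => |c - 1| + (u ω) ^ 2 / 2) P :=
    (integrable_const _).add (hu.integrable_sq.div_const 2)
  have h1 : ∫⁻ ω, epos (fTwo α (x.1 ω, x.2 ω) (u ω) ω) ∂P
      = ENNReal.ofReal (|c - 1| + (∫ ω, (u ω) ^ 2 ∂P) / 2) := by
    have : |c - 1| + (∫ ω, (u ω) ^ 2 ∂P) / 2 = ∫ ω, (|c - 1| + (u ω) ^ 2 / 2) ∂P := by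
      rw [integral_add (integrable_const _) (hu.integrable_sq.div_const 2), integral_div]
      simp
    rw [this, ofReal_integral_eq_lintegral_ofReal hint
      (Filter.Eventually.of_forall fun ω => by positivity)]
    apply lintegral_congr_ae
    filter_upwards [hc, hf] with ω h1 h2
    simp only [fTwo, h1, if_pos h2, epos, EReal.coe_ne_top, if_false, EReal.toReal_coe]
  have h2 : ∫⁻ ω, epos (-(fTwo α (x.1 ω, x.2 ω) (u ω) ω)) ∂P = 0 := by
    rw [← lintegral_zero (μ := P)]
    apply lintegral_congr_ae
    filter_upwards [hc, hf] with ω h1 h2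
    simp only [fTwo, h1, if_pos h2, epos, ← EReal.coe_neg, EReal.coe_ne_top, if_false,
      EReal.toReal_coe]
    apply ENNReal.ofReal_of_nonpos
    have : 0 ≤ |c - 1| + (u ω) ^ 2 / 2 := by positivity
    linarith
  have h0 : 0 ≤ |c - 1| + (∫ ω, (u ω) ^ 2 ∂P) / 2 := by
    have : 0 ≤ ∫ ω, (u ω) ^ 2 ∂P := integral_nonneg fun ω => sq_nonneg _
    positivity
  unfold intFTwo EE
  rw [h1, h2, if_neg ENNReal.ofReal_ne_top, EReal.coe_ennreal_ofReal, max_eq_left h0]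
  simp

lemma aux_top (P : Measure Ω) [IsProbabilityMeasure P] (α : Ω → ℝ) (hα : Measurable α)
    (x : (Ω → ℝ) × (Ω → ℝ)) (hx : Measurable x.2) (u : Ω → ℝ) (hu : MemLp u 2 P) (c : ℝ)
    (hc : x.1 =ᵐ[P] fun _ => c) (hf : ¬ ∀ᵐ ω ∂P, α ω * |c| ≤ x.2 ω) :
    intFTwo P α x u = ⊤ := by
  classical
  unfold intFTwo EE
  rw [if_pos]
  by_contra h
  apply hf
  have he : (fun ω => epos (fTwo α (x.1 ω, x.2 ω) (u ω) ω)) =ᵐ[P]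
      fun ω => if α ω * |c| ≤ x.2 ω then ENNReal.ofReal (|c - 1| + (u ω) ^ 2 / 2) else ⊤ := by
    filter_upwards [hc] with ω h1
    by_cases h2 : α ω * |c| ≤ x.2 ω
    · simp only [fTwo, h1, if_pos h2, epos, EReal.coe_ne_top, if_false, EReal.toReal_coe]
    · simp only [fTwo, h1, if_neg h2, epos, if_true]
  rw [lintegral_congr_ae he] at h
  have hu' : AEMeasurable u P := hu.aestronglyMeasurable.aemeasurable
  have hS : MeasurableSet {ω | α ω * |c| ≤ x.2 ω} := measurableSet_le (hα.mul_const _) hx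
  have hm : AEMeasurable (fun ω => if α ω * |c| ≤ x.2 ω then
      ENNReal.ofReal (|c - 1| + (u ω) ^ 2 / 2) else ⊤) P := by
    obtain ⟨v, hv, huv⟩ := hu'
    refine ⟨fun ω => if α ω * |c| ≤ x.2 ω then
      ENNReal.ofReal (|c - 1| + (v ω) ^ 2 / 2) else ⊤, ?_, ?_⟩
    · exact Measurable.ite hS (by fun_prop) measurable_const
    · filter_upwards [huv] with ω h
      simp only [h]
  filter_upwards [ae_lt_top' hm h] with ω h1
  by_contra h2
  rw [if_neg h2] at h1
  exact lt_irrefl _ h1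

lemma aux_conj (P : Measure Ω) [IsProbabilityMeasure P] (g : (Ω → ℝ) → EReal) (k : ℝ)
    (hg : ∀ u ∈ Ltwo P, g u = ((k + (∫ ω, (u ω) ^ 2 ∂P) / 2 : ℝ) : EReal))
    (y : Ω → ℝ) (hy : y ∈ Ltwo P) :
    conjTwo P g y = (((∫ ω, (y ω) ^ 2 ∂P) / 2 - k : ℝ) : EReal) := by
  have hy' : MemLp y 2 P := hy
  unfold conjTwo
  apply le_antisymm
  · refine iSup₂_le fun u hu => ?_
    have hu' : MemLp u 2 P := hu
    rw [hg u hu, ← EReal.coe_sub, EReal.coe_le_coe_iff]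
    have h : ∫ ω, u ω * y ω ∂P ≤ ∫ ω, ((u ω) ^ 2 / 2 + (y ω) ^ 2 / 2) ∂P := by
      apply integral_mono (hu'.integrable_mul hy')
        ((hu'.integrable_sq.div_const 2).add (hy'.integrable_sq.div_const 2))
      intro ω
      simp only [Pi.add_apply, Pi.mul_apply]
      nlinarith [sq_nonneg (u ω - y ω)]
    rw [integral_add (hu'.integrable_sq.div_const 2) (hy'.integrable_sq.div_const 2),
      integral_div, integral_div] at h
    linarith
  · refine le_iSup₂_of_le y hy ?_
    rw [hg y hy, ← EReal.coe_sub, EReal.coe_le_coe_iff]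
    simp only [← pow_two]
    linarith

/-- the two-period example where `φ̃(u) = 1 + ½E[u²]`, `φ(u) = ½E[u²]`,
`φ̃*(y) = ½E[y²] − 1` and `φ*(y) = ½E[y²]`; in particular `φ̃* ≠ φ*`. -/
theorem stmt_6 (P : Measure Ω) [IsProbabilityMeasure P]
    (ℱ₁ : MeasurableSpace Ω) (hℱ₁ : ℱ₁ ≤ mΩ)
    (α : Ω → ℝ) (hα_meas : Measurable[ℱ₁] α)
    (hα_pos : ∀ᵐ ω ∂P, 0 < α ω)
    (hα_unbdd : ¬ ∃ M : ℝ, ∀ᵐ ω ∂P, α ω ≤ M) :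
    (∀ u ∈ Ltwo P,
      phiTwoTilde P ℱ₁ α u = ((1 + (∫ ω, (u ω) ^ 2 ∂P) / 2 : ℝ) : EReal) ∧
      phiTwo P ℱ₁ α u = (((∫ ω, (u ω) ^ 2 ∂P) / 2 : ℝ) : EReal)) ∧
    (∀ y ∈ Ltwo P,
      conjTwo P (phiTwoTilde P ℱ₁ α) y = (((∫ ω, (y ω) ^ 2 ∂P) / 2 - 1 : ℝ) : EReal) ∧
      conjTwo P (phiTwo P ℱ₁ α) y = (((∫ ω, (y ω) ^ 2 ∂P) / 2 : ℝ) : EReal)) ∧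
    conjTwo P (phiTwoTilde P ℱ₁ α) ≠ conjTwo P (phiTwo P ℱ₁ α) := by
  have hα' : Measurable[mΩ] α := hα_meas.mono hℱ₁ le_rfl
  have ht : ∀ u ∈ Ltwo P,
      phiTwoTilde P ℱ₁ α u = ((1 + (∫ ω, (u ω) ^ 2 ∂P) / 2 : ℝ) : EReal) := by
    intro u hu
    unfold phiTwoTilde
    apply le_antisymm
    · refine iInf₂_le_of_le (fun _ => 0, fun _ => 0) ?_ ?_
      · refine ⟨⟨⟨0, Filter.EventuallyEq.rfl⟩, measurable_const⟩, 0, ?_⟩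
        simp
      · rw [aux_ae P α _ u hu 0 Filter.EventuallyEq.rfl (by simp)]
        simp
    · refine le_iInf₂ fun x hx => ?_
      obtain ⟨⟨⟨c, hc⟩, hx2⟩, M, hM⟩ := hx
      by_cases hf : ∀ᵐ ω ∂P, α ω * |c| ≤ x.2 ω
      · rw [aux_ae P α x u hu c hc hf]
        have : c = 0 := by
          by_contra h0
          apply hα_unbdd
          refine ⟨M / |c|, ?_⟩
          filter_upwards [hf, hM] with ω h1 h2
          rw [le_div_iff₀ (abs_pos.mpr h0)]
          exact h1.trans ((le_abs_self _).trans h2.2)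
        simp [this]
      · rw [aux_top P α hα' x (hx2.mono hℱ₁ le_rfl) u hu c hc hf]
        exact le_top
  have hp : ∀ u ∈ Ltwo P,
      phiTwo P ℱ₁ α u = (((∫ ω, (u ω) ^ 2 ∂P) / 2 : ℝ) : EReal) := by
    intro u hu
    unfold phiTwo
    apply le_antisymm
    · refine iInf₂_le_of_le (fun _ => 1, α) ⟨⟨1, Filter.EventuallyEq.rfl⟩, hα_meas⟩ ?_
      rw [aux_ae P α _ u hu 1 Filter.EventuallyEq.rfl (by simp)]
      simp
    · refine le_iInf₂ fun x hx => ?_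
      obtain ⟨⟨c, hc⟩, hx2⟩ := hx
      by_cases hf : ∀ᵐ ω ∂P, α ω * |c| ≤ x.2 ω
      · rw [aux_ae P α x u hu c hc hf, EReal.coe_le_coe_iff]
        linarith [abs_nonneg (c - 1)]
      · rw [aux_top P α hα' x (hx2.mono hℱ₁ le_rfl) u hu c hc hf]
        exact le_top
  have hct := aux_conj P (phiTwoTilde P ℱ₁ α) 1 ht
  have hcp := aux_conj P (phiTwo P ℱ₁ α) 0 (by simpa only [zero_add] using hp)
  simp only [sub_zero] at hcp
  refine ⟨fun u hu => ⟨ht u hu, hp u hu⟩, fun y hy => ⟨hct y hy, hcp y hy⟩, fun h => ?_⟩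
  have h0 : (fun _ => 0 : Ω → ℝ) ∈ Ltwo P := memLp_const 0
  have h1 := congrFun h (fun _ => 0)
  rw [hct _ h0, hcp _ h0, EReal.coe_eq_coe_iff] at h1
  linarith

end
end

section
/- In the Bolza setting with assumptions (i) and (ii), assume further that 𝓤 carries a barreled locally convex topology compatible with the pairing with 𝓨, that u ↦ Ef(x,u) is closed for every x ∈ 𝓝, that φ is proper, and that there is a convex normal integrand θ on ℝ^{(T+1)d}×Ω with Eθ finite on 𝓤, Eθ* proper on 𝓨, and such that for every adapted u ∈ 𝓤∩𝓝 there exists x ∈ 𝓝 with Σ_{t=0}^T K_t(x_t, Δx_t + u_t) ≤ θ(u) P-a.s. Then for any u ∈ 𝓤∩𝓝, x ∈ 𝓝 solves the problem minimize E Σ_{t=0}^T K_t(x_t, Δx_t + u_t) over x ∈ 𝓝 if and only if x is feasible and there exists adapted y ∈ 𝓨∩𝓝 such that for all t, (E_tΔy_{t+1}, y_t) ∈ ∂K_t(x_t, Δx_t + u_t) P-almost surely; equivalently, for all t, E_tΔy_{t+1} ∈ ∂ₓH_t(x_t,y_t) and u_t + Δx_t ∈ ∂_y[−H_t](x_t,y_t)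 P-almost surely. -/
open MeasureTheory
open scoped ENNReal

noncomputable section

/-- The scalar product on `ℝ^d`. -/
def dotd {d : ℕ} (a b : Fin d → ℝ) : ℝ := ∑ i, a i * b i

/-- The scalar product on `ℝ^{(T+1)d}`. -/
def dotB {T d : ℕ} (a b : Fin (T+1) → Fin d → ℝ) : ℝ := ∑ t, dotd (a t) (b t)

/-- `Δx_t = x_t − x_{t-1}` with the convention `x_{-1} := 0`. -/
def deltaX {T d : ℕ} (x : Fin (T+1) → Fin d → ℝ) (t : Fin (T+1)) : Fin d → ℝ :=
  x t - (if (t : ℕ) = 0 then 0 else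
    x ⟨(t : ℕ) - 1, Nat.lt_of_le_of_lt (Nat.sub_le _ _) t.isLt⟩)

/-- `Δy_{t+1} = y_{t+1} − y_t` with the convention `y_{T+1} := 0`. -/
def deltaNext {T d : ℕ} (y : Fin (T+1) → Fin d → ℝ) (t : Fin (T+1)) : Fin d → ℝ :=
  (if h : (t : ℕ) = T then 0 else
    y ⟨(t : ℕ) + 1, Nat.succ_lt_succ (Nat.lt_of_le_of_ne (Nat.lt_succ_iff.mp t.isLt) h)⟩) - y t

variable {Ω : Type} {mΩ : MeasurableSpace Ω} {T d : ℕ}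

/-- The space `𝓝` of adapted processes. -/
def NBolza (d : ℕ) (ℱ : Fin (T+1) → MeasurableSpace Ω) :
    Set (Ω → Fin (T+1) → Fin d → ℝ) :=
  {x | ∀ t, Measurable[ℱ t] (fun ω => x ω t)}

/-- The space `𝓝^∞` of essentially bounded adapted processes. -/
def NBolzaInf (d : ℕ) (ℱ : Fin (T+1) → MeasurableSpace Ω) (P : Measure Ω) :
    Set (Ω → Fin (T+1) → Fin d → ℝ) :=
  {x | x ∈ NBolza d ℱ ∧ ∃ M : ℝ, ∀ᵐ ω ∂P, ∀ t, ‖x ω t‖ ≤ M}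

/-- The Bolza integrand `f(x,u,ω) = Σ_{t=0}^T K_t(x_t, Δx_t + u_t, ω)`. -/
def fBolza (K : Fin (T+1) → (Fin d → ℝ) → (Fin d → ℝ) → Ω → EReal)
    (x u : Fin (T+1) → Fin d → ℝ) (ω : Ω) : EReal :=
  ∑ t, K t (x t) (deltaX x t + u t) ω

/-- `Ef(x,u)` for the Bolza problem. -/
def intFB (P : Measure Ω) (K : Fin (T+1) → (Fin d → ℝ) → (Fin d → ℝ) → Ω → EReal)
    (x u : Ω → Fin (T+1) → Fin d → ℝ) : EReal :=
  EE P fun ω => fBolza K (x ω) (u ω) ω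

/-- The pairing `⟨u,y⟩ = E(u·y)`. -/
def pairB (P : Measure Ω) (u y : Ω → Fin (T+1) → Fin d → ℝ) : ℝ :=
  ∫ ω, dotB (u ω) (y ω) ∂P

/-- The value function `φ(u) = inf_{x∈𝓝} Ef(x,u)`. -/
def phiB (P : Measure Ω) (K : Fin (T+1) → (Fin d → ℝ) → (Fin d → ℝ) → Ω → EReal)
    (ℱ : Fin (T+1) → MeasurableSpace Ω) (u : Ω → Fin (T+1) → Fin d → ℝ) : EReal :=
  ⨅ x ∈ NBolza d ℱ, intFB P K x u

/-- The auxiliary value function `φ̃(u) = inf_{x∈𝓝^∞} Ef(x,u)`. -/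
def phiBInf (P : Measure Ω) (K : Fin (T+1) → (Fin d → ℝ) → (Fin d → ℝ) → Ω → EReal)
    (ℱ : Fin (T+1) → MeasurableSpace Ω) (u : Ω → Fin (T+1) → Fin d → ℝ) : EReal :=
  ⨅ x ∈ NBolzaInf d ℱ P, intFB P K x u

/-- Conjugate on `𝓨` of a function on `𝓤`. -/
def conjB (P : Measure Ω) (𝓤 : Set (Ω → Fin (T+1) → Fin d → ℝ))
    (g : (Ω → Fin (T+1) → Fin d → ℝ) → EReal) (y : Ω → Fin (T+1) → Fin d → ℝ) : EReal :=
  ⨆ u ∈ 𝓤, (((pairB P u y : ℝ) : EReal) - g u)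

/-- `K_t*(v,y,ω) = sup_{x,u} {x·v + u·y − K_t(x,u,ω)}`. -/
def Kconj (K : Fin (T+1) → (Fin d → ℝ) → (Fin d → ℝ) → Ω → EReal) (t : Fin (T+1))
    (v y : Fin d → ℝ) (ω : Ω) : EReal :=
  ⨆ xx : Fin d → ℝ, ⨆ uu : Fin d → ℝ, (((dotd xx v + dotd uu y : ℝ) : EReal) - K t xx uu ω)

/-- The adapted projection `(ᵃu)_t = E_t u_t`. -/
def aProj (P : Measure Ω) (ℱ : Fin (T+1) → MeasurableSpace Ω)
    (u : Ω → Fin (T+1) → Fin d → ℝ) : Ω → Fin (T+1) → Fin d → ℝ :=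
  fun ω t => (P[fun ω' => u ω' t | ℱ t]) ω

/-- `E_t Δy_{t+1}`, the conditional expectation given `𝓕_t`. -/
def condDelta (P : Measure Ω) (ℱ : Fin (T+1) → MeasurableSpace Ω)
    (y : Ω → Fin (T+1) → Fin d → ℝ) (t : Fin (T+1)) : Ω → Fin d → ℝ :=
  P[fun ω => deltaNext (y ω) t | ℱ t]

/-- `dom₁ Ef`. -/
def dom1B (P : Measure Ω) (K : Fin (T+1) → (Fin d → ℝ) → (Fin d → ℝ) → Ω → EReal)
    (ℱ : Fin (T+1) → MeasurableSpace Ω) (𝓤 : Set (Ω → Fin (T+1) → Fin d → ℝ)) :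
    Set (Ω → Fin (T+1) → Fin d → ℝ) :=
  {x | x ∈ NBolza d ℱ ∧ ∃ u ∈ 𝓤, intFB P K x u < ⊤}

/-- Decomposability of a set of measurable functions. -/
def DecomposableB (P : Measure Ω) (S : Set (Ω → Fin (T+1) → Fin d → ℝ)) : Prop :=
  ∀ A : Set Ω, MeasurableSet A → ∀ u ∈ S, ∀ u' : Ω → Fin (T+1) → Fin d → ℝ,
    Measurable u' → (∃ M : ℝ, ∀ᵐ ω ∂P, ‖u' ω‖ ≤ M) →
    (fun ω => A.indicator u ω + Aᶜ.indicator u' ω) ∈ S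

/-- The Hamiltonian `H_t(x,y,ω) = inf_u {K_t(x,u,ω) − u·y}`. -/
def HamB (K : Fin (T+1) → (Fin d → ℝ) → (Fin d → ℝ) → Ω → EReal) (t : Fin (T+1))
    (x y : Fin d → ℝ) (ω : Ω) : EReal :=
  ⨅ u : Fin d → ℝ, (K t x u ω - ((dotd u y : ℝ) : EReal))

/-- The weak topology `σ(𝓤,𝓨)` on `𝓤`. -/
def weakTopB (P : Measure Ω) (𝓤 𝓨 : Set (Ω → Fin (T+1) → Fin d → ℝ)) :
    TopologicalSpace {u // u ∈ 𝓤} :=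
  TopologicalSpace.induced
    (fun u : {u // u ∈ 𝓤} => fun y : {y // y ∈ 𝓨} => pairB P u.1 y.1) Pi.topologicalSpace

/-- A function on `𝓤` is closed if it is `σ(𝓤,𝓨)`-lower semicontinuous and either proper
or constant. -/
def ClosedFnB (P : Measure Ω) (𝓤 𝓨 : Set (Ω → Fin (T+1) → Fin d → ℝ))
    (g : (Ω → Fin (T+1) → Fin d → ℝ) → EReal) : Prop :=
  (@LowerSemicontinuous _ _ (weakTopB P 𝓤 𝓨) _ (fun u : {u // u ∈ 𝓤} => g u.1)) ∧
  (((∀ u ∈ 𝓤, g u ≠ ⊥) ∧ ∃ u ∈ 𝓤, g u ≠ ⊤) ∨ ∃ c : EReal, ∀ u ∈ 𝓤, g u = c)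

section HelperFacts
open scoped Topology

/-- Reduction of measurable sets in a product to a countably generated factor. -/
theorem sel_reduce {X Ω : Type} [MeasurableSpace X] [MeasurableSpace Ω]
    (S : Set (X × Ω)) (hS : MeasurableSet S) :
    ∃ q : Ω → (ℕ → Bool), Measurable q ∧ ∃ S' : Set (X × (ℕ → Bool)), MeasurableSet S' ∧
      S = (fun p : X × Ω => (p.1, q p.2)) ⁻¹' S' := by
  rw [← generateFrom_prod] at hS
  induction S, hS using MeasurableSpace.generateFrom_induction with
  | hC s hs _ =>
    obtain ⟨A, hA, B, hB, rfl⟩ := hs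
    classical
    refine ⟨fun ω _ => decide (ω ∈ B), ?_, A ×ˢ {b | b 0 = true}, ?_, ?_⟩
    · refine measurable_pi_lambda _ fun _ => ?_
      exact measurable_to_bool (by
        have : (fun ω => decide (ω ∈ B)) ⁻¹' {true} = B := by ext; simp
        rw [this]; exact hB)
    · exact MeasurableSet.prod hA ((measurable_pi_apply (X := fun _ : ℕ => Bool) 0) (measurableSet_singleton true))
    · ext p; simp
  | empty => exact ⟨fun _ _ => true, measurable_const, ∅, MeasurableSet.empty, by simp⟩
  | compl s _ ih =>
    obtain ⟨q, hq, S', hS', rfl⟩ := ih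
    exact ⟨q, hq, S'ᶜ, hS'.compl, by simp⟩
  | iUnion s _ ih =>
    choose q hq S' hS' h using ih
    refine ⟨fun ω n => q n.unpair.1 ω n.unpair.2, ?_,
      ⋃ i, (fun p : X × (ℕ → Bool) => (p.1, fun j => p.2 (Nat.pair i j))) ⁻¹' S' i, ?_, ?_⟩
    · refine measurable_pi_lambda _ fun n => ?_
      exact (measurable_pi_apply _).comp (hq _)
    · refine MeasurableSet.iUnion fun i => ?_
      refine Measurable.comp (g := id) measurable_id ?_ (hS' i)
      refine measurable_fst.prodMk (measurable_pi_lambda _ fun j => ?_)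
      exact (measurable_pi_apply _).comp measurable_snd
    · rw [Set.preimage_iUnion]
      refine Set.iUnion_congr fun i => ?_
      rw [h i]
      ext p
      simp

/-- Capacity: an analytic set of positive outer measure contains the image of a compact
box of positive measure. -/
theorem sel_capacity {Y : Type} [TopologicalSpace Y] [PolishSpace Y] [MeasurableSpace Y]
    [BorelSpace Y] (ν : Measure Y) [IsFiniteMeasure ν] (h : (ℕ → ℕ) → Y) (hh : Continuous h)
    (hpos : ν (Set.range h) ≠ 0) :
    ∃ σ : ℕ → ℕ, ν (h '' {α | ∀ i, α i ≤ σ i}) ≠ 0 := by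
  obtain ⟨c, hc0, hc⟩ := exists_between (pos_iff_ne_zero.mpr hpos)
  -- step
  have step : ∀ (s : Set (ℕ → ℕ)) (n : ℕ), c < ν (h '' s) →
      ∃ m : ℕ, c < ν (h '' (s ∩ {α | α n ≤ m})) := by
    intro s n hs
    have hU : h '' s = ⋃ m : ℕ, h '' (s ∩ {α | α n ≤ m}) := by
      rw [← Set.image_iUnion, ← Set.inter_iUnion]
      congr 1
      symm
      rw [Set.inter_eq_left]
      intro α _
      exact Set.mem_iUnion.2 ⟨α n, le_refl (α n)⟩
    have hmono : Monotone fun m : ℕ => h '' (s ∩ {α | α n ≤ m}) := by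
      intro a b hab
      refine Set.image_mono (Set.inter_subset_inter_right _ ?_)
      intro α hα
      exact le_trans hα hab
    rw [hU, hmono.measure_iUnion] at hs
    exact lt_iSup_iff.1 hs
  choose! g hg using step
  let C : ℕ → Set (ℕ → ℕ) := fun n => Nat.rec Set.univ (fun n s => s ∩ {α | α n ≤ g s n}) n
  have hC0 : C 0 = Set.univ := rfl
  have hCs : ∀ n, C (n+1) = C n ∩ {α | α n ≤ g (C n) n} := fun n => rfl
  have hCpos : ∀ n, c < ν (h '' C n) := by
    intro n
    induction n with
    | zero => rw [hC0, Set.image_univ]; exact hc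
    | succ n ih => rw [hCs]; exact hg _ _ ih
  let σ : ℕ → ℕ := fun n => g (C n) n
  have hCmem : ∀ n α, α ∈ C n ↔ ∀ i < n, α i ≤ σ i := by
    intro n
    induction n with
    | zero => intro α; simp [hC0]
    | succ n ih =>
      intro α
      rw [hCs, Set.mem_inter_iff, ih, Set.mem_ofPred_eq]
      constructor
      · rintro ⟨h1, h2⟩ i hi
        rcases Nat.lt_succ_iff_lt_or_eq.1 hi with hi | rfl
        · exact h1 i hi
        · exact h2
      · intro h1
        exact ⟨fun i hi => h1 i (by omega), h1 n (by omega)⟩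
  refine ⟨σ, ?_⟩
  have hcomp : IsCompact {α : ℕ → ℕ | ∀ i, α i ≤ σ i} := by
    have : {α : ℕ → ℕ | ∀ i, α i ≤ σ i} = Set.univ.pi fun i => Set.Iic (σ i) := by
      ext; simp [Pi.le_def]
    rw [this]
    exact isCompact_univ_pi fun i => (Set.finite_Iic _).isCompact
  have key : c ≤ ν (h '' {α | ∀ i, α i ≤ σ i}) := by
    let := TopologicalSpace.upgradeIsCompletelyMetrizable Y
    rw [Set.measure_eq_iInf_isOpen]
    refine le_iInf fun U => le_iInf fun hU => le_iInf fun hUo => ?_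
    suffices hn : ∃ n, C n ⊆ h ⁻¹' U from by
      obtain ⟨n, hn⟩ := hn
      exact (hCpos n).le.trans (measure_mono (Set.image_subset_iff.2 hn))
    by_contra! hcon
    have : ∀ n, ∃ α ∈ C n, α ∉ h ⁻¹' U := fun n => Set.not_subset.1 (hcon n)
    choose α hα hαU using this
    obtain ⟨β, hβ, k, hk, hlim⟩ := hcomp.tendsto_subseq
      (x := fun n i => min (α n i) (σ i)) (fun n i => min_le_right _ _)
    have hV : h ⁻¹' U ∈ nhds β := (hUo.preimage hh).mem_nhds (Set.image_subset_iff.1 hU hβ)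
    have hlim2 : Filter.Tendsto (fun n => α (k n)) Filter.atTop (nhds β) := by
      rw [tendsto_pi_nhds] at hlim ⊢
      intro i
      refine (hlim i).congr' ?_
      filter_upwards [Filter.eventually_gt_atTop i] with n hn
      have h1 : i < k n := lt_of_lt_of_le hn (hk.id_le n)
      have := (hCmem _ _).1 (hα (k n)) i h1
      simp [this]
    obtain ⟨n, hn⟩ := (hlim2.eventually hV).exists
    exact hαU _ hn
  exact (lt_of_lt_of_le hc0 key).ne'

/-- Borel selection over a compact box. -/
theorem sel_compact {Y : Type} [TopologicalSpace Y] [T2Space Y] [MeasurableSpace Y]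
    [BorelSpace Y] (h : (ℕ → ℕ) → Y) (hh : Continuous h) (σ : ℕ → ℕ) :
    ∃ a : Y → (ℕ → ℕ), Measurable a ∧ ∀ y ∈ h '' {α | ∀ i, α i ≤ σ i}, h (a y) = y := by
  classical
  have hcomp : IsCompact {α : ℕ → ℕ | ∀ i, α i ≤ σ i} := by
    have : {α : ℕ → ℕ | ∀ i, α i ≤ σ i} = Set.univ.pi fun i => Set.Iic (σ i) := by
      ext; simp [Pi.le_def]
    rw [this]
    exact isCompact_univ_pi fun i => (Set.finite_Iic _).isCompact
  set C := {α : ℕ → ℕ | ∀ i, α i ≤ σ i} with hC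
  let cyl : List ℕ → Set (ℕ → ℕ) := fun p => {α | ∀ i < p.length, α i = p.getD i 0}
  have hcyl : ∀ p, IsClosed (cyl p) := by
    intro p
    simp only [cyl, Set.ofPred_forall]
    refine isClosed_iInter fun i => isClosed_iInter fun _ => ?_
    exact isClosed_eq (continuous_apply i) continuous_const
  have hmeas : ∀ p, MeasurableSet (h '' (C ∩ cyl p)) := fun p =>
    ((hcomp.inter_right (hcyl p)).image hh).isClosed.measurableSet
  let g : List ℕ → Y → ℕ := fun p y =>
    if H : ∃ m, y ∈ h '' (C ∩ cyl (p ++ [m])) then Nat.find H else 0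
  have hg : ∀ p, Measurable (g p) := by
    intro p
    have hE : MeasurableSet {y | ∃ m, y ∈ h '' (C ∩ cyl (p ++ [m]))} := by
      rw [Set.ofPred_exists]
      exact MeasurableSet.iUnion fun m => hmeas _
    refine measurable_to_countable' fun m => ?_
    have : g p ⁻¹' {m} = ({y | ∃ m, y ∈ h '' (C ∩ cyl (p ++ [m]))} ∩
        (h '' (C ∩ cyl (p ++ [m])) ∩ ⋂ j, ⋂ (_ : j < m), (h '' (C ∩ cyl (p ++ [j])))ᶜ)) ∪
        ({y | ∃ m, y ∈ h '' (C ∩ cyl (p ++ [m]))}ᶜ ∩ {_y | m = 0}) := by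
      ext y
      by_cases H : ∃ m, y ∈ h '' (C ∩ cyl (p ++ [m]))
      · have e : g p y = Nat.find H := dif_pos H
        simp only [Set.mem_preimage, Set.mem_singleton_iff, e, Nat.find_eq_iff, Set.mem_union,
          Set.mem_inter_iff, Set.mem_iInter, Set.mem_compl_iff, Set.mem_ofPred_eq]
        tauto
      · have e : g p y = 0 := dif_neg H
        simp only [Set.mem_preimage, Set.mem_singleton_iff, e, Set.mem_union,
          Set.mem_inter_iff, Set.mem_iInter, Set.mem_compl_iff, Set.mem_ofPred_eq]
        constructor
        · intro h0; exact Or.inr ⟨H, h0.symm⟩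
        · rintro (h1 | h1)
          · exact absurd h1.1 H
          · exact h1.2.symm
    rw [this]
    refine MeasurableSet.union (hE.inter ((hmeas _).inter ?_)) (hE.compl.inter (MeasurableSet.const _))
    exact MeasurableSet.iInter fun j => MeasurableSet.iInter fun _ => (hmeas _).compl
  let _ : MeasurableSpace (List ℕ) := ⊤
  obtain ⟨r, hr0, hrs⟩ : ∃ r : ℕ → Y → List ℕ, (∀ y, r 0 y = []) ∧
      ∀ n y, r (n+1) y = r n y ++ [g (r n y) y] :=
    ⟨fun n => Nat.rec (fun _ => []) (fun _ f y => f y ++ [g (f y) y]) n, fun _ => rfl,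
      fun _ _ => rfl⟩
  have hrlen : ∀ n y, (r n y).length = n := by
    intro n y
    induction n with
    | zero => rw [hr0]; rfl
    | succ n ih => rw [hrs]; simp [ih]
  have hrm : ∀ n, Measurable (r n) := by
    intro n
    induction n with
    | zero =>
      have : r 0 = fun _ => [] := funext hr0
      rw [this]; exact measurable_const
    | succ n ih =>
      have h2 : Measurable (fun q : List ℕ × Y => q.1 ++ [g q.1 q.2]) :=
        measurable_from_prod_countable_right fun p =>
          (Measurable.of_discrete (f := fun k : ℕ => p ++ [k])).comp (hg p)
      have h3 : r (n+1) = fun y => r n y ++ [g (r n y) y] := funext (hrs n)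
      rw [h3]
      exact h2.comp (ih.prodMk measurable_id)
  refine ⟨fun y n => g (r n y) y, ?_, ?_⟩
  · refine measurable_pi_lambda _ fun n => ?_
    have h2 : Measurable (fun q : List ℕ × Y => g q.1 q.2) :=
      measurable_from_prod_countable_right fun p => hg p
    exact h2.comp ((hrm n).prodMk measurable_id)
  · intro y hy
    have hin : ∀ n, y ∈ h '' (C ∩ cyl (r n y)) := by
      intro n
      induction n with
      | zero => simpa [hr0, cyl] using hy
      | succ n ih =>
        obtain ⟨β, ⟨hβ, hβc⟩, hβy⟩ := ih
        have H : ∃ m, y ∈ h '' (C ∩ cyl (r n y ++ [m])) := by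
          refine ⟨β n, β, ⟨hβ, ?_⟩, hβy⟩
          intro i hi
          rw [List.length_append, hrlen, List.length_singleton] at hi
          rcases Nat.lt_succ_iff_lt_or_eq.1 hi with hi | rfl
          · rw [List.getD_append _ _ _ _ (by rw [hrlen]; exact hi)]
            exact hβc i (by rw [hrlen]; exact hi)
          · rw [List.getD_append_right _ _ _ _ (by rw [hrlen])]
            simp [hrlen]
        rw [hrs]
        have e : g (r n y) y = Nat.find H := dif_pos H
        rw [e]
        exact Nat.find_spec H
    have hra : ∀ n i, i < n → (r n y).getD i 0 = g (r i y) y := by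
      intro n
      induction n with
      | zero => intro i hi; omega
      | succ n ih =>
        intro i hi
        rw [hrs]
        rcases Nat.lt_succ_iff_lt_or_eq.1 hi with hi | rfl
        · rw [List.getD_append _ _ _ _ (by rw [hrlen]; exact hi)]
          exact ih i hi
        · rw [List.getD_append_right _ _ _ _ (by rw [hrlen])]
          simp [hrlen]
    choose β hβ hβy using hin
    have hlim : Filter.Tendsto β Filter.atTop (nhds fun n => g (r n y) y) := by
      rw [tendsto_pi_nhds]
      intro i
      refine tendsto_const_nhds.congr' ?_
      filter_upwards [Filter.eventually_gt_atTop i] with n hn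
      have := (hβ n).2 i (by rw [hrlen]; exact hn)
      rw [this, hra n i hn]
    have h2 := (hh.tendsto _).comp hlim
    have h3 : h ∘ β = fun _ => y := by ext1 n; exact hβy n
    rw [h3] at h2
    exact (tendsto_nhds_unique h2 tendsto_const_nhds)

/-- Measurable selection on a set of positive measure. -/
theorem sel_main {X Ω : Type} [TopologicalSpace X] [PolishSpace X] [MeasurableSpace X]
    [BorelSpace X] [Nonempty X] {m : MeasurableSpace Ω} (μ : Measure Ω) [IsFiniteMeasure μ]
    (S : Set (X × Ω)) (hS : MeasurableSet S) (hpos : μ {ω | ∃ p, (p, ω) ∈ S} ≠ 0) :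
    ∃ A : Set Ω, MeasurableSet A ∧ μ A ≠ 0 ∧ ∃ s : Ω → X, Measurable s ∧
      ∀ ω ∈ A, (s ω, ω) ∈ S := by
  obtain ⟨q, hq, S', hS', rfl⟩ := sel_reduce S hS
  have hPB : PolishSpace (ℕ → Bool) := ⟨⟩
  have han := hS'.analyticSet
  rw [AnalyticSet] at han
  rcases han with rfl | ⟨f, hf, hfr⟩
  · simp at hpos
  let h : (ℕ → ℕ) → (ℕ → Bool) := fun α => (f α).2
  have hh : Continuous h := continuous_snd.comp hf
  have hp : (μ.map q) (Set.range h) ≠ 0 := by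
    refine (lt_of_lt_of_le (pos_iff_ne_zero.2 hpos)
      (le_trans (measure_mono ?_) (Measure.le_map_apply hq.aemeasurable _))).ne'
    rintro ω ⟨p, hp⟩
    have hp' : (p, q ω) ∈ S' := hp
    rw [← hfr] at hp'
    obtain ⟨α, hα⟩ := hp'
    exact ⟨α, by simp [h, hα]⟩
  obtain ⟨σ, hσ⟩ := sel_capacity (μ.map q) h hh hp
  obtain ⟨a, ha, hay⟩ := sel_compact h hh σ
  have hcomp : IsCompact {α : ℕ → ℕ | ∀ i, α i ≤ σ i} := by
    have : {α : ℕ → ℕ | ∀ i, α i ≤ σ i} = Set.univ.pi fun i => Set.Iic (σ i) := by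
      ext; simp [Pi.le_def]
    rw [this]
    exact isCompact_univ_pi fun i => (Set.finite_Iic _).isCompact
  have hm : MeasurableSet (h '' {α | ∀ i, α i ≤ σ i}) := (hcomp.image hh).isClosed.measurableSet
  refine ⟨q ⁻¹' (h '' {α | ∀ i, α i ≤ σ i}), hq hm, ?_, fun ω => (f (a (q ω))).1, ?_, ?_⟩
  · rwa [Measure.map_apply hq hm] at hσ
  · exact (continuous_fst.comp hf).measurable.comp (ha.comp hq)
  · intro ω hω
    have h1 : (f (a (q ω))).2 = q ω := hay _ hω
    show ((f (a (q ω))).1, q ω) ∈ S'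
    rw [← hfr]
    exact ⟨a (q ω), Prod.ext rfl h1⟩


theorem epos_coe (r : ℝ) : epos (r : EReal) = ENNReal.ofReal r := by
  simp [epos]

theorem epos_top : epos ⊤ = ⊤ := by simp [epos]

theorem epos_bot : epos ⊥ = 0 := by simp [epos]

theorem epos_mono {a b : EReal} (h : a ≤ b) : epos a ≤ epos b := by
  induction b with
  | top => rw [epos_top]; exact le_top
  | bot => rw [le_bot_iff.1 h]
  | coe b =>
    induction a with
    | top => exact absurd h (by simp)
    | bot => rw [epos_bot]; exact zero_le
    | coe a =>
      rw [epos_coe, epos_coe]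
      exact ENNReal.ofReal_le_ofReal (EReal.coe_le_coe_iff.1 h)

theorem measurable_epos : Measurable epos := by
  unfold epos
  refine Measurable.ite (measurableSet_singleton ⊤) measurable_const ?_
  exact ENNReal.measurable_ofReal.comp measurable_ereal_toReal

theorem EE_congr {Ω : Type} {mΩ : MeasurableSpace Ω} {P : Measure Ω} {φ ψ : Ω → EReal}
    (h : φ =ᵐ[P] ψ) : EE P φ = EE P ψ := by
  have h1 : ∫⁻ ω, epos (φ ω) ∂P = ∫⁻ ω, epos (ψ ω) ∂P :=
    lintegral_congr_ae (h.mono fun ω hω => by simp only [hω])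
  have h2 : ∫⁻ ω, epos (-(φ ω)) ∂P = ∫⁻ ω, epos (-(ψ ω)) ∂P :=
    lintegral_congr_ae (h.mono fun ω hω => by simp only [hω])
  unfold EE
  rw [h1, h2]

theorem EE_coe {Ω : Type} {mΩ : MeasurableSpace Ω} {P : Measure Ω} {g : Ω → ℝ}
    (hg : Integrable g P) : EE P (fun ω => (g ω : EReal)) = ((∫ ω, g ω ∂P : ℝ) : EReal) := by
  have e : ∀ ω, epos (-(g ω : EReal)) = ENNReal.ofReal (-(g ω)) := fun ω => by
    rw [← EReal.coe_neg, epos_coe]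
  unfold EE
  simp only [epos_coe, e]
  have f1 : ∫⁻ ω, ENNReal.ofReal (g ω) ∂P ≠ ⊤ := hg.lintegral_lt_top.ne
  have f2 : ∫⁻ ω, ENNReal.ofReal (-(g ω)) ∂P ≠ ⊤ := hg.neg.lintegral_lt_top.ne
  rw [if_neg f1, integral_eq_lintegral_pos_part_sub_lintegral_neg_part hg, EReal.coe_sub,
    ← EReal.coe_ennreal_toReal f1, ← EReal.coe_ennreal_toReal f2]

theorem EE_congr_coe {Ω : Type} {mΩ : MeasurableSpace Ω} {P : Measure Ω} {φ : Ω → EReal}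
    {g : Ω → ℝ} (hg : Integrable g P) (h : ∀ᵐ ω ∂P, φ ω = (g ω : EReal)) :
    EE P φ = ((∫ ω, g ω ∂P : ℝ) : EReal) := by
  rw [EE_congr h, EE_coe hg]

/-- A measurable function with `EE` different from both infinities is a.e. real and integrable. -/
theorem EE_real {Ω : Type} {mΩ : MeasurableSpace Ω} {P : Measure Ω} {φ : Ω → EReal}
    (hφ : Measurable φ) (h1 : EE P φ ≠ ⊤) (h2 : EE P φ ≠ ⊥) :
    Integrable (fun ω => (φ ω).toReal) P ∧ ∀ᵐ ω ∂P, φ ω = ((φ ω).toReal : EReal) := by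
  have f1 : ∫⁻ ω, epos (φ ω) ∂P ≠ ⊤ := by
    intro h; apply h1; unfold EE; rw [if_pos h]
  have f2 : ∫⁻ ω, epos (-(φ ω)) ∂P ≠ ⊤ := by
    intro h; apply h2; unfold EE; rw [if_neg f1, h, ← EReal.coe_ennreal_toReal f1]
    rfl
  have m1 : Measurable fun ω => epos (φ ω) := measurable_epos.comp hφ
  have m2 : Measurable fun ω => epos (-(φ ω)) := measurable_epos.comp hφ.neg
  have a1 := ae_lt_top m1 f1
  have a2 := ae_lt_top m2 f2
  have hae : ∀ᵐ ω ∂P, φ ω = ((φ ω).toReal : EReal) := by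
    filter_upwards [a1, a2] with ω w1 w2
    rw [EReal.coe_toReal]
    · intro h; rw [h, epos_top] at w1; exact lt_irrefl _ w1
    · intro h; rw [h, EReal.neg_bot, epos_top] at w2; exact lt_irrefl _ w2
  refine ⟨⟨hφ.ereal_toReal.aestronglyMeasurable, ?_⟩, hae⟩
  rw [hasFiniteIntegral_iff_norm]
  refine lt_of_le_of_lt (lintegral_mono_ae ?_)
    (b := ∫⁻ ω, (epos (φ ω) + epos (-(φ ω))) ∂P) ?_
  · filter_upwards [hae] with ω w
    rw [w, ← EReal.coe_neg, epos_coe, epos_coe, EReal.toReal_coe, Real.norm_eq_abs]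
    rcases le_total 0 (φ ω).toReal with h | h
    · rw [abs_of_nonneg h]; exact le_self_add
    · rw [abs_of_nonpos h]; exact le_add_self
  · rw [lintegral_add_left m1]
    exact ENNReal.add_lt_top.2 ⟨f1.lt_top, f2.lt_top⟩

theorem EE_mono {Ω : Type} {mΩ : MeasurableSpace Ω} {P : Measure Ω} {φ ψ : Ω → EReal}
    (h : ∀ᵐ ω ∂P, φ ω ≤ ψ ω) : EE P φ ≤ EE P ψ := by
  have h1 : ∫⁻ ω, epos (φ ω) ∂P ≤ ∫⁻ ω, epos (ψ ω) ∂P :=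
    lintegral_mono_ae (h.mono fun ω hω => epos_mono hω)
  have h2 : ∫⁻ ω, epos (-(ψ ω)) ∂P ≤ ∫⁻ ω, epos (-(φ ω)) ∂P :=
    lintegral_mono_ae (h.mono fun ω hω => epos_mono (EReal.neg_le_neg_iff.2 hω))
  unfold EE
  by_cases hp : ∫⁻ ω, epos (ψ ω) ∂P = ⊤
  · rw [if_pos hp]; exact le_top
  · rw [if_neg hp, if_neg (ne_top_of_le_ne_top hp h1)]
    exact EReal.sub_le_sub (EReal.coe_ennreal_le_coe_ennreal_iff.2 h1)
      (EReal.coe_ennreal_le_coe_ennreal_iff.2 h2)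

/-- Hahn--Banach for convex majorants. -/
theorem hb_convex {E : Type*} [AddCommGroup E] [Module ℝ E] (f : E →ₗ.[ℝ] ℝ) (q : E → ℝ)
    (hq : ∀ (a b : ℝ) (x y : E), 0 < a → 0 < b → a + b = 1 →
      q (a • x + b • y) ≤ a * q x + b * q y)
    (hf : ∀ x : f.domain, f x ≤ q x) :
    ∃ g : E →ₗ[ℝ] ℝ, (∀ x : f.domain, g x = f x) ∧ ∀ x, g x ≤ q x := by
  have hq0 : 0 ≤ q 0 := by
    have := hf 0
    simpa using this
  have lowb : ∀ (x : E) (l : ℝ), 0 < l → -q (-x) ≤ l⁻¹ * q (l • x) := by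
    intro x l hl
    have h1 := hq (1 / (1 + l)) (l / (1 + l)) (l • x) (-x) (by positivity) (by positivity)
      (by field_simp)
    have e : (1 / (1 + l)) • (l • x) + (l / (1 + l)) • (-x) = 0 := by
      rw [smul_smul, smul_neg, ← sub_eq_add_neg, ← sub_smul]
      have : 1 / (1 + l) * l - l / (1 + l) = 0 := by field_simp; ring
      rw [this, zero_smul]
    rw [e] at h1
    have h2 : 0 ≤ (q (l • x) + l * q (-x)) / (1 + l) := by
      refine (hq0.trans h1).trans (le_of_eq ?_)
      field_simp
    have h3 : 0 ≤ q (l • x) + l * q (-x) := by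
      by_contra h
      push Not at h
      exact absurd h2 (not_le.2 (div_neg_of_neg_of_pos h (by positivity)))
    rw [← sub_nonneg]
    have : l⁻¹ * q (l • x) - -q (-x) = l⁻¹ * (q (l • x) + l * q (-x)) := by
      field_simp; ring
    rw [this]
    positivity
  let N : E → ℝ := fun x => ⨅ l : Set.Ioi (0:ℝ), (l : ℝ)⁻¹ * q ((l : ℝ) • x)
  have hne : Nonempty (Set.Ioi (0:ℝ)) := ⟨⟨1, Set.mem_Ioi.2 one_pos⟩⟩
  have hbdd : ∀ x, BddBelow (Set.range fun l : Set.Ioi (0:ℝ) => (l : ℝ)⁻¹ * q ((l : ℝ) • x)) := by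
    intro x
    refine ⟨-q (-x), ?_⟩
    rintro _ ⟨l, rfl⟩
    exact lowb x l l.2
  have Nle : ∀ x (l : ℝ), 0 < l → N x ≤ l⁻¹ * q (l • x) := fun x l hl =>
    ciInf_le (hbdd x) ⟨l, hl⟩
  have hNhom1 : ∀ c : ℝ, 0 < c → ∀ x, N (c • x) ≤ c * N x := by
    intro c hc x
    have : N (c • x) / c ≤ N x := by
      refine le_ciInf fun l => ?_
      have h1 := Nle (c • x) (l / c) (div_pos l.2 hc)
      rw [smul_smul, div_mul_cancel₀ _ hc.ne'] at h1
      rw [div_le_iff₀ hc]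
      refine h1.trans (le_of_eq ?_)
      have := (show (0:ℝ) < l from l.2).ne'
      field_simp
    rwa [div_le_iff₀ hc, mul_comm] at this
  have hNhom : ∀ c : ℝ, 0 < c → ∀ x, N (c • x) = c * N x := by
    intro c hc x
    refine le_antisymm (hNhom1 c hc x) ?_
    have := hNhom1 c⁻¹ (inv_pos.2 hc) (c • x)
    rw [smul_smul, inv_mul_cancel₀ hc.ne', one_smul] at this
    calc c * N x ≤ c * (c⁻¹ * N (c • x)) := by gcongr
      _ = N (c • x) := by field_simp
  have hNadd : ∀ x y, N (x + y) ≤ N x + N y := by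
    intro x y
    have key : ∀ l m : Set.Ioi (0:ℝ), N (x + y) ≤ (l:ℝ)⁻¹ * q ((l:ℝ) • x) + (m:ℝ)⁻¹ * q ((m:ℝ) • y) := by
      rintro ⟨l, hl⟩ ⟨m, hm⟩
      have hl' : 0 < l := hl
      have hm' : 0 < m := hm
      have h1 := Nle (x + y) (l * m / (l + m)) (by positivity)
      have h2 := hq (m / (l + m)) (l / (l + m)) (l • x) (m • y) (by positivity) (by positivity)
        (by field_simp; ring)
      have e : (l * m / (l + m)) • (x + y) = (m / (l + m)) • (l • x) + (l / (l + m)) • (m • y) := by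
        rw [smul_smul, smul_smul, smul_add]
        congr 2 <;> ring
      rw [← e] at h2
      refine h1.trans ?_
      calc (l * m / (l + m))⁻¹ * q ((l * m / (l + m)) • (x + y))
          ≤ (l * m / (l + m))⁻¹ * (m / (l + m) * q (l • x) + l / (l + m) * q (m • y)) := by
            gcongr
        _ = _ := by field_simp
    have h1 : N (x + y) - N x ≤ N y := by
      refine le_ciInf fun m => ?_
      have : N (x + y) - (m:ℝ)⁻¹ * q ((m:ℝ) • y) ≤ N x := by
        refine le_ciInf fun l => ?_
        linarith [key l m]
      linarith
    linarith
  obtain ⟨g, hg1, hg2⟩ := exists_extension_of_le_sublinear f N hNhom hNadd (by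
    intro x
    refine le_ciInf fun l => ?_
    have hl : (0:ℝ) < l := l.2
    have h1 := hf ((l:ℝ) • x)
    rw [f.map_smul, smul_eq_mul] at h1
    rw [inv_mul_eq_div, le_div_iff₀ hl, mul_comm]
    exact h1)
  refine ⟨g, hg1, fun x => (hg2 x).trans ?_⟩
  have := Nle x 1 one_pos
  simpa using this


theorem dotd_add_left {d : ℕ} (a b c : Fin d → ℝ) : dotd (a + b) c = dotd a c + dotd b c := by
  simp [dotd, add_mul, Finset.sum_add_distrib]

theorem dotd_smul_left {d : ℕ} (r : ℝ) (a c : Fin d → ℝ) : dotd (r • a) c = r * dotd a c := by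
  simp [dotd, Finset.mul_sum, mul_assoc]

theorem dotd_comm {d : ℕ} (a b : Fin d → ℝ) : dotd a b = dotd b a := by
  simp [dotd, mul_comm]

theorem dotd_sub_left {d : ℕ} (a b c : Fin d → ℝ) : dotd (a - b) c = dotd a c - dotd b c := by
  simp [dotd, sub_mul, Finset.sum_sub_distrib]

theorem dotd_sub_right {d : ℕ} (a b c : Fin d → ℝ) : dotd c (a - b) = dotd c a - dotd c b := by
  rw [dotd_comm, dotd_sub_left, dotd_comm a, dotd_comm b]

theorem dotd_add_right {d : ℕ} (a b c : Fin d → ℝ) : dotd c (a + b) = dotd c a + dotd c b := by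
  rw [dotd_comm, dotd_add_left, dotd_comm a, dotd_comm b]

theorem clm_eq_dotd {d : ℕ} (l : (Fin d → ℝ) →ₗ[ℝ] ℝ) : ∃ y : Fin d → ℝ, ∀ u, l u = dotd u y := by
  refine ⟨fun i => l (Pi.single i 1), fun u => ?_⟩
  have h := LinearMap.pi_apply_eq_sum_univ l u
  rw [h]
  simp only [dotd, smul_eq_mul]
  refine Finset.sum_congr rfl fun i _ => ?_
  congr 2
  ext j
  simp [Pi.single_apply, eq_comm]

/-- Finite-dimensional Fenchel--Moreau at a point of the domain. -/
theorem fenchel_point {d : ℕ} (k : (Fin d → ℝ) → EReal) (hlsc : LowerSemicontinuous k)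
    (hbot : ∀ u, k u ≠ ⊥)
    (hconv : ∀ (a b : ℝ) (u₁ u₂ : Fin d → ℝ), 0 < a → 0 < b → a + b = 1 →
      k (a • u₁ + b • u₂) ≤ (a : EReal) * k u₁ + (b : EReal) * k u₂)
    (w : Fin d → ℝ) (c : ℝ) (hw : k w = (c : EReal)) (r : ℝ) (hr : r < c) :
    ∃ y : Fin d → ℝ, ∀ u, ((r + dotd (u - w) y : ℝ) : EReal) ≤ k u := by
  let S : Set ((Fin d → ℝ) × ℝ) := {p | k p.1 ≤ (p.2 : EReal)}
  have hSconv : Convex ℝ S := by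
    intro p hp q hq a b ha hb hab
    rcases ha.eq_or_lt with rfl | ha
    · simp at hab; subst hab; simpa using hq
    rcases hb.eq_or_lt with rfl | hb
    · simp at hab; subst hab; simpa using hp
    show k (a • p.1 + b • q.1) ≤ ((a * p.2 + b * q.2 : ℝ) : EReal)
    refine (hconv a b p.1 q.1 ha hb hab).trans ?_
    rw [EReal.coe_add, EReal.coe_mul, EReal.coe_mul]
    have ha' : (0 : EReal) ≤ a := EReal.coe_nonneg.2 ha.le
    have hb' : (0 : EReal) ≤ b := EReal.coe_nonneg.2 hb.le
    exact add_le_add (mul_le_mul_of_nonneg_left hp ha') (mul_le_mul_of_nonneg_left hq hb')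
  have hSclosed : IsClosed S := by
    have : S = {p : (Fin d → ℝ) × EReal | k p.1 ≤ p.2}.preimage
        (fun p : (Fin d → ℝ) × ℝ => (p.1, (p.2 : EReal))) := rfl
    rw [this]
    refine IsClosed.preimage ?_ hlsc.isClosed_epigraph
    exact continuous_fst.prodMk (continuous_coe_real_ereal.comp continuous_snd)
  have hnot : (w, r) ∉ S := by
    intro h
    have h' : k w ≤ (r : EReal) := h
    rw [hw, EReal.coe_le_coe_iff] at h'
    linarith
  obtain ⟨f, s, hs1, hs2⟩ := geometric_hahn_banach_point_closed hSconv hSclosed hnot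
  obtain ⟨y, hy⟩ := clm_eq_dotd (f.toLinearMap ∘ₗ LinearMap.inl ℝ (Fin d → ℝ) ℝ)
  have hf : ∀ u t, f (u, t) = dotd u y + t * f (0, 1) := by
    intro u t
    have e : ((u, t) : (Fin d → ℝ) × ℝ) = (u, 0) + t • (0, 1) := by simp
    rw [e, map_add, map_smul, smul_eq_mul, ← hy]
    rfl
  have hc := hs2 (w, c) (show k w ≤ (c : EReal) from hw.le)
  rw [hf] at hs1 hc
  set β := f (0, 1) with hβ
  have hβpos : 0 < β := by nlinarith
  refine ⟨(-β⁻¹) • y, fun u => ?_⟩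
  induction hk : k u with
  | bot => exact absurd hk (hbot u)
  | top => exact le_top
  | coe t =>
    rw [EReal.coe_le_coe_iff]
    have h2 := hs2 (u, t) (show k u ≤ (t : EReal) from hk.le)
    rw [hf] at h2
    have h3 : dotd w y + r * β < dotd u y + t * β := hs1.trans h2
    rw [dotd_comm, dotd_smul_left, dotd_comm, dotd_sub_left]
    have : r + -β⁻¹ * (dotd u y - dotd w y) - t = β⁻¹ * (dotd w y + r * β - (dotd u y + t * β)) := by
      field_simp; ring
    have h4 : β⁻¹ * (dotd w y + r * β - (dotd u y + t * β)) ≤ 0 :=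
      mul_nonpos_of_nonneg_of_nonpos (by positivity) (by linarith)
    linarith

/-- Pointwise equivalence of the Euler--Lagrange and Hamiltonian inclusions. -/
theorem ham_iff {d : ℕ} (k : (Fin d → ℝ) → (Fin d → ℝ) → EReal)
    (hbot : ∀ x u, k x u ≠ ⊥)
    (hlsc : LowerSemicontinuous (fun p : (Fin d → ℝ) × (Fin d → ℝ) => k p.1 p.2))
    (hconv : ∀ (a b : ℝ) (x₁ x₂ u₁ u₂ : Fin d → ℝ), 0 < a → 0 < b → a + b = 1 →
      k (a • x₁ + b • x₂) (a • u₁ + b • u₂) ≤ (a : EReal) * k x₁ u₁ + (b : EReal) * k x₂ u₂)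
    (x w v y : Fin d → ℝ) (c : ℝ) (hw : k x w = (c : EReal)) :
    (∀ x' u', k x w + ((dotd v (x' - x) + dotd y (u' - w) : ℝ) : EReal) ≤ k x' u') ↔
    ((∀ x', (⨅ u, (k x u - ((dotd u y : ℝ) : EReal))) + ((dotd v (x' - x) : ℝ) : EReal) ≤
        ⨅ u, (k x' u - ((dotd u y : ℝ) : EReal))) ∧
     (∀ y', -(⨅ u, (k x u - ((dotd u y : ℝ) : EReal))) + ((dotd w (y' - y) : ℝ) : EReal) ≤
        -(⨅ u, (k x u - ((dotd u y' : ℝ) : EReal))))) := by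
  have aux : ∀ (a r : ℝ) (z : EReal), (a : EReal) ≤ z - (r : EReal) ↔ ((a + r : ℝ) : EReal) ≤ z := by
    intro a r z
    induction z with
    | bot => simp
    | top => simp
    | coe z =>
      rw [← EReal.coe_sub, EReal.coe_le_coe_iff, EReal.coe_le_coe_iff]
      constructor <;> intro h <;> linarith
  have hHle : ∀ y', (⨅ u, (k x u - ((dotd u y' : ℝ) : EReal))) ≤ ((c - dotd w y' : ℝ) : EReal) := by
    intro y'
    refine (iInf_le _ w).trans (le_of_eq ?_)
    rw [hw, ← EReal.coe_sub]
  constructor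
  · intro h
    have hH : (⨅ u, (k x u - ((dotd u y : ℝ) : EReal))) = ((c - dotd w y : ℝ) : EReal) := by
      refine le_antisymm (hHle y) (le_iInf fun u => ?_)
      rw [aux]
      refine le_trans (le_of_eq ?_) (h x u)
      rw [hw, ← EReal.coe_add]
      congr 1
      rw [dotd_sub_right, dotd_sub_right, dotd_comm y u, dotd_comm y w]
      ring
    refine ⟨fun x' => ?_, fun y' => ?_⟩
    · rw [hH, ← EReal.coe_add]
      refine le_iInf fun u => ?_
      rw [aux]
      refine le_trans (le_of_eq ?_) (h x' u)
      rw [hw, ← EReal.coe_add]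
      congr 1
      rw [dotd_sub_right u w y, dotd_comm y u, dotd_comm y w]
      ring
    · rw [hH, ← EReal.coe_neg, ← EReal.coe_add, EReal.le_neg]
      refine (hHle y').trans ?_
      rw [← EReal.coe_neg, EReal.coe_le_coe_iff, dotd_sub_right]
      linarith
  · rintro ⟨h1, h2⟩
    have hH : (⨅ u, (k x u - ((dotd u y : ℝ) : EReal))) = ((c - dotd w y : ℝ) : EReal) := by
      refine le_antisymm (hHle y) ?_
      refine EReal.ge_of_forall_gt_iff_ge.1 fun z hz => ?_
      rw [EReal.coe_lt_coe_iff] at hz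
      set r : ℝ := z + dotd w y with hr
      have hrc : r < c := by linarith
      obtain ⟨p, hp⟩ := fenchel_point (k x)
        (hlsc.comp (show Continuous fun u : Fin d → ℝ => (x, u) by fun_prop)) (hbot x)
        (fun a b u₁ u₂ ha hb hab => by
          have := hconv a b x x u₁ u₂ ha hb hab
          rwa [← add_smul, hab, one_smul] at this) w c hw r hrc
      have hp1 : ((r - dotd w p : ℝ) : EReal) ≤ ⨅ u, (k x u - ((dotd u p : ℝ) : EReal)) := by
        refine le_iInf fun u => ?_
        rw [aux]
        refine le_trans (le_of_eq ?_) (hp u)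
        congr 1
        rw [dotd_sub_left]; ring
      have h3 := (h2 p).trans (EReal.neg_le_neg_iff.2 hp1)
      induction hI : (⨅ u, (k x u - ((dotd u y : ℝ) : EReal))) with
      | top => exact le_top
      | bot =>
        rw [hI, EReal.neg_bot, EReal.top_add_coe, ← EReal.coe_neg] at h3
        exact absurd (top_le_iff.1 h3) (EReal.coe_ne_top _)
      | coe e =>
        rw [hI, ← EReal.coe_neg, ← EReal.coe_neg, ← EReal.coe_add, EReal.coe_le_coe_iff,
          dotd_sub_right] at h3
        rw [EReal.coe_le_coe_iff]
        linarith
    intro x' u'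
    have h3 := (h1 x').trans (iInf_le _ u')
    rw [hH, ← EReal.coe_add, aux] at h3
    refine le_trans (le_of_eq ?_) h3
    rw [hw, ← EReal.coe_add]
    congr 1
    rw [dotd_sub_right u' w y, dotd_comm y u', dotd_comm y w]
    ring


theorem mart_step {Ω : Type} {m mΩ : MeasurableSpace Ω} (P : Measure Ω) [IsProbabilityMeasure P]
    (hm : m ≤ mΩ) {ι : Type} (s : Finset ι) (z v : ι → Ω → ℝ) (g : Ω → ℝ)
    (hz : ∀ i ∈ s, Measurable[m] (z i)) (hv : ∀ i ∈ s, Integrable (v i) P) (hg : Integrable g P)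
    (hle : ∀ᵐ ω ∂P, ∑ i ∈ s, z i ω * v i ω ≤ g ω) :
    (∀ᵐ ω ∂P, ∑ i ∈ s, z i ω * (P[v i | m]) ω ≤ (P[g | m]) ω) ∧
    (Integrable (fun ω => ∑ i ∈ s, z i ω * (P[v i | m]) ω) P →
      Integrable (fun ω => ∑ i ∈ s, z i ω * v i ω) P ∧
      ∫ ω, ∑ i ∈ s, z i ω * v i ω ∂P = ∫ ω, ∑ i ∈ s, z i ω * (P[v i | m]) ω ∂P) := by
  let A : ℕ → Set Ω := fun k => ⋂ i ∈ s, {ω | |z i ω| ≤ k}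
  have hA : ∀ k, MeasurableSet[m] (A k) := fun k =>
    Finset.measurableSet_biInter s fun i hi => by
      have h1 : Measurable[m] fun ω => |z i ω| := continuous_abs.measurable.comp (hz i hi)
      exact h1 measurableSet_Iic
  have hAev : ∀ ω, ∀ᶠ k in Filter.atTop, ω ∈ A k := by
    intro ω
    have h1 : ∀ᶠ k : ℕ in Filter.atTop, ∑ i ∈ s, |z i ω| ≤ (k : ℝ) :=
      (tendsto_natCast_atTop_atTop).eventually_ge_atTop _
    filter_upwards [h1] with k hk
    simp only [A, Set.mem_iInter]
    intro i hi
    exact (Finset.single_le_sum (f := fun i => |z i ω|) (fun _ _ => abs_nonneg _) hi).trans hk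
  have hcov : AECover P Filter.atTop A :=
    ⟨Filter.Eventually.of_forall hAev, fun k => hm _ (hA k)⟩
  -- truncated pieces
  have hsm : ∀ k, ∀ i ∈ s, StronglyMeasurable[m] ((A k).indicator (z i)) := fun k i hi =>
    ((hz i hi).indicator (hA k)).stronglyMeasurable
  have hb : ∀ k, ∀ i ∈ s, ∀ ω, ‖(A k).indicator (z i) ω‖ ≤ (k : ℝ) := by
    intro k i hi ω
    by_cases h : ω ∈ A k
    · rw [Set.indicator_of_mem h]
      simp only [A, Set.mem_iInter] at h
      exact h i hi
    · rw [Set.indicator_of_notMem h]; simp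
  have hint : ∀ k, ∀ i ∈ s, ∀ w : Ω → ℝ, Integrable w P →
      Integrable ((A k).indicator (z i) * w) P := fun k i hi w hw =>
    hw.bdd_mul (c := (k : ℝ)) ((hsm k i hi).mono hm).aestronglyMeasurable
      (Filter.Eventually.of_forall (hb k i hi))
  have hind : ∀ k (w : ι → Ω → ℝ), (A k).indicator (fun ω => ∑ i ∈ s, z i ω * w i ω)
      = ∑ i ∈ s, (A k).indicator (z i) * w i := by
    intro k w
    ext ω
    simp only [Finset.sum_apply, Pi.mul_apply]
    by_cases h : ω ∈ A k
    · simp [Set.indicator_of_mem h]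
    · simp [Set.indicator_of_notMem h]
  have hint2 : ∀ k (w : ι → Ω → ℝ), (∀ i ∈ s, Integrable (w i) P) →
      Integrable ((A k).indicator (fun ω => ∑ i ∈ s, z i ω * w i ω)) P := by
    intro k w hw
    rw [hind]
    exact integrable_finsetSum' _ fun i hi => hint k i hi _ (hw i hi)
  have hce : ∀ k, P[(A k).indicator (fun ω => ∑ i ∈ s, z i ω * v i ω) | m] =ᵐ[P]
      (A k).indicator (fun ω => ∑ i ∈ s, z i ω * (P[v i | m]) ω) := by
    intro k
    rw [hind, hind]
    refine (condExp_finsetSum (fun i hi => hint k i hi _ (hv i hi)) m).trans ?_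
    have : ∀ᵐ ω ∂P, ∀ i ∈ s, (P[(A k).indicator (z i) * v i | m]) ω
        = ((A k).indicator (z i) * P[v i | m]) ω := by
      rw [Finset.eventually_all]
      intro i hi
      exact condExp_stronglyMeasurable_mul_of_bound hm (hsm k i hi) (hv i hi) k
        (Filter.Eventually.of_forall (hb k i hi))
    filter_upwards [this] with ω hω
    simp only [Finset.sum_apply]
    exact Finset.sum_congr rfl hω
  have hset : ∀ k, ∫ ω in A k, ∑ i ∈ s, z i ω * v i ω ∂P
      = ∫ ω in A k, ∑ i ∈ s, z i ω * (P[v i | m]) ω ∂P := by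
    intro k
    rw [← integral_indicator (hm _ (hA k)), ← integral_indicator (hm _ (hA k)),
      ← integral_congr_ae (hce k), integral_condExp hm]
  constructor
  · have : ∀ᵐ ω ∂P, ∀ k, (A k).indicator (fun ω => ∑ i ∈ s, z i ω * (P[v i | m]) ω) ω ≤
        (A k).indicator (P[g | m]) ω := by
      rw [ae_all_iff]
      intro k
      have h1 : P[(A k).indicator (fun ω => ∑ i ∈ s, z i ω * v i ω) | m] ≤ᵐ[P]
          P[(A k).indicator g | m] := by
        refine condExp_mono (hint2 k v hv) (hg.indicator (hm _ (hA k))) ?_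
        filter_upwards [hle] with ω hω
        by_cases h : ω ∈ A k
        · simpa [Set.indicator_of_mem h] using hω
        · simp [Set.indicator_of_notMem h]
      filter_upwards [h1, hce k, condExp_indicator hg (hA k)] with ω a b c
      rw [← b, ← c]; exact a
    filter_upwards [this] with ω hω
    obtain ⟨k, hk⟩ := (hAev ω).exists
    simpa [Set.indicator_of_mem hk] using hω k
  · intro hR'
    have hI : ∀ k, IntegrableOn (fun ω => ∑ i ∈ s, z i ω * v i ω) (A k) P := fun k =>
      (integrable_indicator_iff (hm _ (hA k))).1 (hint2 k v hv)
    have hh : Integrable (fun ω => g ω - ∑ i ∈ s, z i ω * v i ω) P := by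
      refine hcov.integrable_of_integral_tendsto_of_nonneg_ae
        (∫ ω, g ω ∂P - ∫ ω, ∑ i ∈ s, z i ω * (P[v i | m]) ω ∂P)
        (fun k => hg.integrableOn.sub (hI k))
        (hle.mono fun ω hω => sub_nonneg.2 hω) ?_
      have h1 := (hcov.integral_tendsto_of_countably_generated hg).sub
        (hcov.integral_tendsto_of_countably_generated hR')
      refine h1.congr fun k => ?_
      rw [integral_sub hg.integrableOn (hI k), hset]
    have hR : Integrable (fun ω => ∑ i ∈ s, z i ω * v i ω) P := by
      refine (hg.sub hh).congr (Filter.Eventually.of_forall fun ω => ?_)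
      simp
    refine ⟨hR, ?_⟩
    have h1 := hcov.integral_tendsto_of_countably_generated hR
    have h2 := hcov.integral_tendsto_of_countably_generated hR'
    refine tendsto_nhds_unique h1 (h2.congr fun k => (hset k).symm)

theorem mart_main {Ω : Type} {mΩ : MeasurableSpace Ω} (P : Measure Ω) [IsProbabilityMeasure P]
    {N : ℕ} (ℱ : Fin N → MeasurableSpace Ω) (hℱ : ∀ t, ℱ t ≤ mΩ) (hmono : Monotone ℱ)
    {ι : Type} (l : ι → Fin N) (z : ι → Ω → ℝ) (n : ℕ) :
    ∀ (s : Finset ι) (v : ι → Ω → ℝ) (g : Ω → ℝ), (∀ i ∈ s, (l i : ℕ) < n) →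
    (∀ i ∈ s, Measurable[ℱ (l i)] (z i)) → (∀ i ∈ s, Integrable (v i) P) →
    (∀ i ∈ s, P[v i | ℱ (l i)] =ᵐ[P] 0) → Integrable g P →
    (∀ᵐ ω ∂P, ∑ i ∈ s, z i ω * v i ω ≤ g ω) →
    Integrable (fun ω => ∑ i ∈ s, z i ω * v i ω) P ∧ ∫ ω, ∑ i ∈ s, z i ω * v i ω ∂P = 0 := by
  induction n with
  | zero =>
    intro s v g hl _ _ _ _ _
    have : s = ∅ := Finset.eq_empty_of_forall_notMem fun i hi => by
      have := hl i hi; omega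
    subst this
    simp
  | succ n ih =>
    intro s v g hl hz hv hv0 hg hle
    by_cases hn : n < N
    swap
    · exact ih s v g (fun i _ => by have := (l i).2; omega) hz hv hv0 hg hle
    let t : Fin N := ⟨n, hn⟩
    have hlt : ∀ i ∈ s, l i ≤ t := fun i hi => by
      have := hl i hi
      exact Fin.le_def.2 (by simp [t]; omega)
    obtain ⟨h1, h2⟩ := mart_step P (hℱ t) s z v g
      (fun i hi => (hz i hi).mono (hmono (hlt i hi)) le_rfl) hv hg hle
    have h0 : ∀ᵐ ω ∂P, ∀ i ∈ s, ¬ ((l i : ℕ) < n) → (P[v i | ℱ t]) ω = 0 := by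
      rw [Finset.eventually_all]
      intro i hi
      by_cases h : (l i : ℕ) < n
      · exact Filter.Eventually.of_forall fun ω h' => absurd h h'
      · have : l i = t := by
          apply Fin.ext; have := hl i hi; simp [t]; omega
        filter_upwards [this ▸ hv0 i hi] with ω hω _
        exact hω
    have heq : ∀ᵐ ω ∂P, ∑ i ∈ s with (l i : ℕ) < n, z i ω * (P[v i | ℱ t]) ω
        = ∑ i ∈ s, z i ω * (P[v i | ℱ t]) ω := by
      filter_upwards [h0] with ω hω
      rw [Finset.sum_filter]
      refine Finset.sum_congr rfl fun i hi => ?_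
      by_cases h : (l i : ℕ) < n
      · rw [if_pos h]
      · rw [if_neg h, hω i hi h, mul_zero]
    obtain ⟨h3, h4⟩ := ih (s.filter fun i => (l i : ℕ) < n) (fun i => P[v i | ℱ t]) (P[g | ℱ t])
      (fun i hi => (Finset.mem_filter.1 hi).2)
      (fun i hi => hz i (Finset.mem_filter.1 hi).1)
      (fun i hi => integrable_condExp)
      (fun i hi => (condExp_condExp_of_le (hmono (hlt i (Finset.mem_filter.1 hi).1)) (hℱ t)).trans
        (hv0 i (Finset.mem_filter.1 hi).1))
      integrable_condExp
      (by filter_upwards [heq, h1] with ω a b; rw [a]; exact b)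
    obtain ⟨h5, h6⟩ := h2 (h3.congr heq)
    refine ⟨h5, ?_⟩
    rw [h6, ← h4]
    exact (integral_congr_ae heq).symm


theorem sum_parts {T d : ℕ} (y z : Fin (T+1) → Fin d → ℝ) :
    ∑ t, dotd (y t) (deltaX z t) = - ∑ t, dotd (z t) (deltaNext y t) := by
  have h1 : ∀ t, dotd (y t) (deltaX z t) = dotd (y t) (z t) - dotd (y t) (if (t : ℕ) = 0 then 0 else
    z ⟨(t : ℕ) - 1, Nat.lt_of_le_of_lt (Nat.sub_le _ _) t.isLt⟩) := fun t => by
    rw [deltaX, dotd_sub_right]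
  have h2 : ∀ t, dotd (z t) (deltaNext y t) = dotd (z t) (if h : (t : ℕ) = T then 0 else
    y ⟨(t : ℕ) + 1, Nat.succ_lt_succ (Nat.lt_of_le_of_ne (Nat.lt_succ_iff.mp t.isLt) h)⟩)
      - dotd (y t) (z t) := fun t => by
    rw [deltaNext, dotd_sub_right, dotd_comm (z t) (y t)]
  have h3 : ∑ t, dotd (y t) (if (t : ℕ) = 0 then 0 else
      z ⟨(t : ℕ) - 1, Nat.lt_of_le_of_lt (Nat.sub_le _ _) t.isLt⟩)
      = ∑ t : Fin (T+1), dotd (z t) (if h : (t : ℕ) = T then 0 else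
    y ⟨(t : ℕ) + 1, Nat.succ_lt_succ (Nat.lt_of_le_of_ne (Nat.lt_succ_iff.mp t.isLt) h)⟩) := by
    rw [Fin.sum_univ_succ, Fin.sum_univ_castSucc]
    have e1 : dotd (y 0) 0 = 0 := by simp [dotd]
    have e2 : dotd (z (Fin.last T)) 0 = 0 := by simp [dotd]
    simp only [Fin.val_zero, if_true, Fin.val_last, dite_true, e1, e2, zero_add, add_zero]
    refine Finset.sum_congr rfl fun t _ => ?_
    rw [if_neg (by simp), dif_neg (by simpa using t.2.ne), dotd_comm]
    rfl
  rw [Finset.sum_congr rfl fun t _ => h1 t, Finset.sum_congr rfl fun t _ => h2 t,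
    Finset.sum_sub_distrib, Finset.sum_sub_distrib, h3]
  ring

theorem ereal_sum_ne_bot {ι : Type} (s : Finset ι) (f : ι → EReal) (h : ∀ i ∈ s, f i ≠ ⊥) :
    ∑ i ∈ s, f i ≠ ⊥ := by
  classical
  induction s using Finset.induction_on with
  | empty => simp
  | insert a s ha ih =>
    rw [Finset.sum_insert ha]
    have h1 := ih fun i hi => h i (Finset.mem_insert_of_mem hi)
    have h2 := h a (Finset.mem_insert_self _ _)
    simp [EReal.add_eq_bot_iff, h1, h2]

theorem ereal_sum_finite {ι : Type} (s : Finset ι) (f : ι → EReal) (h : ∀ i ∈ s, f i ≠ ⊥)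
    (ht : ∑ i ∈ s, f i ≠ ⊤) : ∀ i ∈ s, f i ≠ ⊤ := by
  classical
  intro i hi hf
  apply ht
  rw [← Finset.add_sum_erase s f hi, hf]
  exact EReal.top_add_of_ne_bot
    (ereal_sum_ne_bot _ _ fun j hj => h j (Finset.mem_of_mem_erase hj))

theorem ereal_sum_coe {ι : Type} (s : Finset ι) (f : ι → ℝ) :
    ∑ i ∈ s, (f i : EReal) = ((∑ i ∈ s, f i : ℝ) : EReal) := by
  classical
  induction s using Finset.induction_on with
  | empty => simp
  | insert a s ha ih => rw [Finset.sum_insert ha, Finset.sum_insert ha, ih, EReal.coe_add]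

theorem fB_real {Ω : Type} {T d : ℕ} (K : Fin (T+1) → (Fin d → ℝ) → (Fin d → ℝ) → Ω → EReal)
    (hK : ∀ t ω, (∀ x u, K t x u ω ≠ ⊥))
    (x u : Fin (T+1) → Fin d → ℝ) (ω : Ω) (h : fBolza K x u ω ≠ ⊤) :
    (∀ t, K t (x t) (deltaX x t + u t) ω = ((K t (x t) (deltaX x t + u t) ω).toReal : EReal)) ∧
    (fBolza K x u ω).toReal = ∑ t, (K t (x t) (deltaX x t + u t) ω).toReal := by
  have h1 : ∀ t, K t (x t) (deltaX x t + u t) ω =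
      ((K t (x t) (deltaX x t + u t) ω).toReal : EReal) := fun t =>
    (EReal.coe_toReal (ereal_sum_finite _ _ (fun t _ => hK t ω _ _) h t (Finset.mem_univ _))
      (hK t ω _ _)).symm
  refine ⟨h1, ?_⟩
  unfold fBolza
  rw [Finset.sum_congr rfl fun t _ => h1 t, ereal_sum_coe, EReal.toReal_coe]

theorem meas_deltaX {Ω : Type} {T d : ℕ} (ℱ : Fin (T+1) → MeasurableSpace Ω)
    (hmono : Monotone ℱ) (x : Ω → Fin (T+1) → Fin d → ℝ) (hx : x ∈ NBolza d ℱ) (t : Fin (T+1)) :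
    Measurable[ℱ t] fun ω => deltaX (x ω) t := by
  unfold deltaX
  refine Measurable.sub (hx t) ?_
  by_cases h : (t : ℕ) = 0
  · simp only [h, if_true]; exact measurable_const
  · simp only [h, if_false]
    exact (hx _).mono (hmono (Fin.le_def.2 (Nat.sub_le _ _))) le_rfl

theorem meas_K_aux {Ω : Type} {m : MeasurableSpace Ω} {d : ℕ}
    (k : (Fin d → ℝ) → (Fin d → ℝ) → Ω → EReal)
    (hk : Measurable (fun p : ((Fin d → ℝ) × (Fin d → ℝ)) × Ω => k p.1.1 p.1.2 p.2))
    (ξ η : Ω → Fin d → ℝ) (hξ : Measurable ξ) (hη : Measurable η) :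
    Measurable fun ω => k (ξ ω) (η ω) ω :=
  hk.comp ((hξ.prodMk hη).prodMk measurable_id)

theorem meas_K {Ω : Type} {T d : ℕ} (ℱ : Fin (T+1) → MeasurableSpace Ω)
    (K : Fin (T+1) → (Fin d → ℝ) → (Fin d → ℝ) → Ω → EReal)
    (hK_meas : ∀ t, @Measurable (((Fin d → ℝ) × (Fin d → ℝ)) × Ω) EReal
      (MeasurableSpace.prod inferInstance (ℱ t)) _ (fun p => K t p.1.1 p.1.2 p.2))
    (t : Fin (T+1)) (ξ η : Ω → Fin d → ℝ) (hξ : Measurable[ℱ t] ξ) (hη : Measurable[ℱ t] η) :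
    Measurable[ℱ t] fun ω => K t (ξ ω) (η ω) ω :=
  meas_K_aux (m := ℱ t) (K t) (hK_meas t) ξ η hξ hη

theorem meas_fB {Ω : Type} {mΩ : MeasurableSpace Ω} {T d : ℕ} (ℱ : Fin (T+1) → MeasurableSpace Ω)
    (hle : ∀ t, ℱ t ≤ mΩ) (hmono : Monotone ℱ)
    (K : Fin (T+1) → (Fin d → ℝ) → (Fin d → ℝ) → Ω → EReal)
    (hK_meas : ∀ t, @Measurable (((Fin d → ℝ) × (Fin d → ℝ)) × Ω) EReal
      (MeasurableSpace.prod inferInstance (ℱ t)) _ (fun p => K t p.1.1 p.1.2 p.2))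
    (x u : Ω → Fin (T+1) → Fin d → ℝ) (hx : x ∈ NBolza d ℱ) (hu : u ∈ NBolza d ℱ) :
    Measurable fun ω => fBolza K (x ω) (u ω) ω := by
  unfold fBolza
  refine Finset.measurable_fun_sum _ fun t _ => ?_
  exact (meas_K ℱ K hK_meas t _ _ (hx t) ((meas_deltaX ℱ hmono x hx t).add (hu t))).mono (hle t) le_rfl


theorem dec_bdd {Ω : Type} {mΩ : MeasurableSpace Ω} {T d : ℕ} (P : Measure Ω)
    (S : Submodule ℝ (Ω → Fin (T+1) → Fin d → ℝ))
    (hS : DecomposableB P (S : Set (Ω → Fin (T+1) → Fin d → ℝ)))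
    (u : Ω → Fin (T+1) → Fin d → ℝ) (hu : Measurable u) (M : ℝ) (hM : ∀ ω t i, |u ω t i| ≤ M) :
    u ∈ S := by
  have h := hS ∅ MeasurableSet.empty 0 S.zero_mem u hu ⟨|M|, Filter.Eventually.of_forall fun ω => by
    refine (pi_norm_le_iff_of_nonneg (abs_nonneg _)).2 fun t => ?_
    refine (pi_norm_le_iff_of_nonneg (abs_nonneg _)).2 fun i => ?_
    exact (hM ω t i).trans (le_abs_self _)⟩
  simpa using h

theorem coord_int {Ω : Type} {mΩ : MeasurableSpace Ω} {T d : ℕ} (P : Measure Ω)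
    (S : Submodule ℝ (Ω → Fin (T+1) → Fin d → ℝ))
    (hS : DecomposableB P (S : Set (Ω → Fin (T+1) → Fin d → ℝ)))
    (y : Ω → Fin (T+1) → Fin d → ℝ) (hy : Measurable y)
    (hp : ∀ u ∈ S, Integrable (fun ω => dotB (u ω) (y ω)) P) (t : Fin (T+1)) (i : Fin d) :
    Integrable (fun ω => y ω t i) P := by
  have hm : Measurable fun ω => y ω t i := by fun_prop
  let sg : Ω → ℝ := fun ω => if 0 ≤ y ω t i then 1 else -1
  have hsg : Measurable sg :=
    Measurable.ite (measurableSet_le measurable_const hm) measurable_const measurable_const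
  have h := hp (fun ω t' i' => if t' = t ∧ i' = i then sg ω else 0) (by
    refine dec_bdd P S hS _ ?_ 1 ?_
    · refine measurable_pi_iff.2 fun t' => measurable_pi_iff.2 fun i' => ?_
      by_cases h : t' = t ∧ i' = i
      · simpa only [h, if_true, and_self] using hsg
      · simp only [h, if_false]; exact measurable_const
    · intro ω t' i'
      simp only [sg]
      split_ifs <;> simp)
  have e : ∀ ω, dotB (fun t' i' => if t' = t ∧ i' = i then sg ω else 0) (y ω) = ‖y ω t i‖ := by
    intro ω
    unfold dotB dotd
    rw [Finset.sum_eq_single t, Finset.sum_eq_single i]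
    · simp only [and_self, if_true, sg, Real.norm_eq_abs]
      split_ifs with h0
      · rw [one_mul, abs_of_nonneg h0]
      · rw [abs_of_neg (not_le.1 h0)]; ring
    · intro j _ hj; simp [hj]
    · simp
    · intro j _ hj; simp [hj]
    · simp
  simp only [e] at h
  exact (integrable_norm_iff hm.aestronglyMeasurable).1 h

theorem condExp_coord {Ω : Type} {m mΩ : MeasurableSpace Ω} {d : ℕ} (P : Measure Ω)
    [IsProbabilityMeasure P] (w : Ω → Fin d → ℝ)
    (hw : ∀ i, Integrable (fun ω => w ω i) P) (i : Fin d) :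
    (fun ω => (P[w | m]) ω i) =ᵐ[P] P[fun ω => w ω i | m] :=
  ContinuousLinearMap.comp_condExp_comm (m := m) (Integrable.of_eval hw)
    (ContinuousLinearMap.proj (R := ℝ) (φ := fun _ : Fin d => ℝ) i)

theorem deltaNext_int {Ω : Type} {mΩ : MeasurableSpace Ω} {T d : ℕ} (P : Measure Ω)
    (y : Ω → Fin (T+1) → Fin d → ℝ) (hy : ∀ t i, Integrable (fun ω => y ω t i) P)
    (t : Fin (T+1)) (i : Fin d) : Integrable (fun ω => deltaNext (y ω) t i) P := by
  unfold deltaNext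
  by_cases h : (t : ℕ) = T
  · simp only [h, dite_true, Pi.sub_apply, Pi.zero_apply, zero_sub]
    exact (hy t i).neg
  · simp only [h, dite_false, Pi.sub_apply]
    exact (hy _ i).sub (hy t i)

theorem deltaX_sub {T d : ℕ} (x x' : Fin (T+1) → Fin d → ℝ) (t : Fin (T+1)) :
    deltaX (x' - x) t = deltaX x' t - deltaX x t := by
  unfold deltaX
  split_ifs
  · simp
  · simp only [Pi.sub_apply]; abel

theorem suff_main {Ω : Type} {mΩ : MeasurableSpace Ω} (P : Measure Ω) [IsProbabilityMeasure P]
    {T d : ℕ} (ℱ : Fin (T+1) → MeasurableSpace Ω)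
    (hℱ_le : ∀ t, ℱ t ≤ mΩ) (hℱ_mono : Monotone ℱ)
    (K : Fin (T+1) → (Fin d → ℝ) → (Fin d → ℝ) → Ω → EReal)
    (hK_meas : ∀ t, @Measurable (((Fin d → ℝ) × (Fin d → ℝ)) × Ω) EReal
      (MeasurableSpace.prod inferInstance (ℱ t)) _ (fun p => K t p.1.1 p.1.2 p.2))
    (hK : ∀ t ω, (∀ x u, K t x u ω ≠ ⊥))
    (u x x' y : Ω → Fin (T+1) → Fin d → ℝ) (hu : u ∈ NBolza d ℱ) (hx : x ∈ NBolza d ℱ)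
    (hx' : x' ∈ NBolza d ℱ) (hy : ∀ t i, Integrable (fun ω => y ω t i) P)
    (hE1 : intFB P K x u ≠ ⊤) (hE2 : intFB P K x u ≠ ⊥)
    (hE1' : intFB P K x' u ≠ ⊤) (hE2' : intFB P K x' u ≠ ⊥)
    (hEL : ∀ t, ∀ᵐ ω ∂P, ∀ x' u' : Fin d → ℝ,
              K t (x ω t) (deltaX (x ω) t + u ω t) ω +
                ((dotd (condDelta P ℱ y t ω) (x' - x ω t) +
                  dotd (y ω t) (u' - (deltaX (x ω) t + u ω t)) : ℝ) : EReal) ≤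
                K t x' u' ω) :
    intFB P K x u ≤ intFB P K x' u := by
  obtain ⟨i1, r1⟩ := EE_real (meas_fB ℱ hℱ_le hℱ_mono K hK_meas x u hx hu) hE1 hE2
  obtain ⟨i2, r2⟩ := EE_real (meas_fB ℱ hℱ_le hℱ_mono K hK_meas x' u hx' hu) hE1' hE2'
  let z : Fin (T+1) × Fin d → Ω → ℝ := fun p ω => x' ω p.1 p.2 - x ω p.1 p.2
  let v : Fin (T+1) × Fin d → Ω → ℝ := fun p ω =>
    condDelta P ℱ y p.1 ω p.2 - deltaNext (y ω) p.1 p.2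
  have hR : ∀ ω, ∑ p, z p ω * v p ω = ∑ t, (dotd (condDelta P ℱ y t ω) (x' ω t - x ω t) +
      dotd (y ω t) ((deltaX (x' ω) t + u ω t) - (deltaX (x ω) t + u ω t))) := by
    intro ω
    have e : ∀ t, (deltaX (x' ω) t + u ω t) - (deltaX (x ω) t + u ω t) = deltaX (x' ω - x ω) t := by
      intro t; rw [deltaX_sub]; abel
    simp only [e]
    rw [Finset.sum_add_distrib, sum_parts, ← sub_eq_add_neg, ← Finset.sum_sub_distrib,
      Fintype.sum_prod_type]
    refine Finset.sum_congr rfl fun t _ => ?_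
    simp only [dotd, z, v]
    rw [← Finset.sum_sub_distrib]
    refine Finset.sum_congr rfl fun i _ => ?_
    simp only [Pi.sub_apply]
    ring
  have hle : ∀ᵐ ω ∂P, ∑ p, z p ω * v p ω ≤
      (fBolza K (x' ω) (u ω) ω).toReal - (fBolza K (x ω) (u ω) ω).toReal := by
    filter_upwards [r1, r2, ae_all_iff.2 hEL] with ω a b c
    obtain ⟨a1, a2⟩ := fB_real K hK (x ω) (u ω) ω (by rw [a]; exact EReal.coe_ne_top _)
    obtain ⟨b1, b2⟩ := fB_real K hK (x' ω) (u ω) ω (by rw [b]; exact EReal.coe_ne_top _)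
    rw [a2, b2, hR, ← Finset.sum_sub_distrib]
    refine Finset.sum_le_sum fun t _ => ?_
    have := c t (x' ω t) (deltaX (x' ω) t + u ω t)
    rw [a1, b1, ← EReal.coe_add, EReal.coe_le_coe_iff] at this
    linarith
  have hvi : ∀ p, Integrable (v p) P := fun p => by
    refine Integrable.sub ?_ (deltaNext_int P y hy _ _)
    have h1 : Integrable (condDelta P ℱ y p.1) P := integrable_condExp
    exact h1.eval p.2
  obtain ⟨h1, h2⟩ := mart_main P ℱ hℱ_le hℱ_mono (Prod.fst) z (T+1) Finset.univ v _
    (fun p _ => p.1.2)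
    (fun p _ => by
      have a1 : Measurable[ℱ p.1] fun ω => x' ω p.1 p.2 := (measurable_pi_apply p.2).comp (hx' p.1)
      have a2 : Measurable[ℱ p.1] fun ω => x ω p.1 p.2 := (measurable_pi_apply p.2).comp (hx p.1)
      exact Measurable.sub a1 a2)
    (fun p _ => hvi p)
    (fun p _ => by
      have a1 : v p =ᵐ[P] (P[fun ω => deltaNext (y ω) p.1 p.2 | ℱ p.1]) -
          fun ω => deltaNext (y ω) p.1 p.2 := by
        filter_upwards [condExp_coord (m := ℱ p.1) P (fun ω => deltaNext (y ω) p.1)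
          (fun i => deltaNext_int P y hy _ _) p.2] with ω hω
        simp only [v, condDelta, Pi.sub_apply, hω]
      refine (condExp_congr_ae a1).trans ?_
      refine (condExp_sub integrable_condExp (deltaNext_int P y hy _ _) _).trans ?_
      filter_upwards [condExp_condExp_of_le (f := fun ω => deltaNext (y ω) p.1 p.2) (μ := P)
        (le_refl (ℱ p.1)) (hℱ_le p.1)] with ω hω
      simp only [Pi.sub_apply, hω, sub_self, Pi.zero_apply])
    (i2.sub i1) hle
  have h3 := integral_mono_ae h1 (i2.sub i1) hle
  rw [h2] at h3
  have h4 : ∫ ω, (fBolza K (x' ω) (u ω) ω).toReal - (fBolza K (x ω) (u ω) ω).toReal ∂P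
    = _ := integral_sub i2 i1
  unfold intFB
  rw [EE_congr_coe i1 r1, EE_congr_coe i2 r2, EReal.coe_le_coe_iff]
  simp only [Pi.sub_apply] at h3
  rw [h4] at h3
  linarith


theorem meas_minorant {Ω : Type} {mΩ : MeasurableSpace Ω} (P : Measure Ω) (f : Ω → ℝ≥0∞)
    (hf : ∫⁻ ω, f ω ∂P ≠ ⊤) : ∃ m : Ω → ℝ≥0∞, Measurable m ∧ ∫⁻ ω, m ω ∂P ≠ ⊤ ∧
      ∀ q : Ω → ℝ≥0∞, Measurable q → (∀ᵐ ω ∂P, q ω ≤ f ω) → ∀ᵐ ω ∂P, q ω ≤ m ω := by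
  obtain ⟨m, hm, hle, heq⟩ := exists_measurable_le_lintegral_eq P f
  refine ⟨m, hm, heq ▸ hf, fun q hq hqf => ?_⟩
  have h := ae_eq_of_ae_le_of_lintegral_le (μ := P) (f := m) (g := fun ω => max (m ω) (q ω))
    (Filter.Eventually.of_forall fun ω => le_max_left _ _) (heq ▸ hf) (hm.max hq).aemeasurable
    (by rw [← heq]; exact lintegral_mono_ae (hqf.mono fun ω hω => max_le (hle ω) hω))
  filter_upwards [h] with ω hω
  rw [hω]; exact le_max_right _ _

theorem le_epos (a : EReal) : a ≤ ((epos a : ℝ≥0∞) : EReal) := by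
  induction a with
  | top => rw [epos_top]; exact le_top
  | bot => exact bot_le
  | coe r =>
    rw [epos_coe, EReal.coe_ennreal_ofReal, EReal.coe_le_coe_iff]
    exact le_max_left _ _

theorem absorbent_of {E : Type*} [AddCommGroup E] [Module ℝ E] (S : Set E)
    (h : ∀ x : E, ∃ δ > 0, ∀ r : ℝ, |r| ≤ δ → r • x ∈ S) : Absorbent ℝ S := by
  intro x
  obtain ⟨δ, hδ, h⟩ := h x
  refine Absorbs.of_norm ⟨δ⁻¹, fun c hc => ?_⟩
  rw [Set.singleton_subset_iff]
  have hc0 : c ≠ 0 := by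
    rintro rfl
    rw [norm_zero] at hc
    exact absurd (inv_pos.2 hδ) (not_lt.2 hc)
  rw [Set.mem_smul_set_iff_inv_smul_mem₀ hc0]
  apply h
  rw [abs_inv]
  exact inv_le_of_inv_le₀ hδ hc

theorem absorbent_convex {E : Type*} [AddCommGroup E] [Module ℝ E] (q : E → ℝ)
    (hq : ∀ (a b : ℝ) (x y : E), 0 < a → 0 < b → a + b = 1 →
      q (a • x + b • y) ≤ a * q x + b * q y) (c : ℝ) (hc : q 0 < c) :
    Absorbent ℝ {x | q x ≤ c} := by
  refine absorbent_of _ fun x => ?_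
  let M := |q x - q 0| + |q (-x) - q 0| + 1
  have hM : 0 < M := by positivity
  have key : ∀ w, |q w - q 0| ≤ M → ∀ s : ℝ, 0 ≤ s → s < 1 → s ≤ (c - q 0) / M →
      q (s • w) ≤ c := by
    intro w hw s h0 h1 h2
    rcases h0.eq_or_lt with rfl | h0
    · rw [zero_smul]; exact hc.le
    have := hq (1 - s) s 0 w (by linarith) h0 (by ring)
    rw [smul_zero, zero_add] at this
    rw [le_div_iff₀ hM] at h2
    have h3 : s * (q w - q 0) ≤ s * M := by
      apply mul_le_mul_of_nonneg_left ((le_abs_self _).trans hw) h0.le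
    linarith
  refine ⟨min (1/2) ((c - q 0) / M), lt_min (by norm_num) (div_pos (by linarith) hM),
    fun r hr => ?_⟩
  have hr1 := hr.trans (min_le_left _ _)
  have hr2 := hr.trans (min_le_right _ _)
  have e1 : |q x - q 0| ≤ M := by
    have := abs_nonneg (q (-x) - q 0); simp only [M]; linarith
  have e2 : |q (-x) - q 0| ≤ M := by
    have := abs_nonneg (q (x) - q 0); simp only [M]; linarith
  show q (r • x) ≤ c
  rcases le_total 0 r with h | h
  · rw [abs_of_nonneg h] at hr1 hr2
    exact key x e1 r h (by linarith) hr2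
  · rw [abs_of_nonpos h] at hr1 hr2
    have := key (-x) e2 (-r) (by linarith) (by linarith) hr2
    rwa [neg_smul_neg] at this

theorem theta_fatou {Ω : Type} {mΩ : MeasurableSpace Ω} (P : Measure Ω) {T d : ℕ}
    (θ : (Fin (T+1) → Fin d → ℝ) → Ω → EReal) (hθ_lsc : ∀ ω, LowerSemicontinuous (fun z => θ z ω))
    (v : ℕ → Ω → Fin (T+1) → Fin d → ℝ) (v0 yb : Ω → Fin (T+1) → Fin d → ℝ)
    (hv : ∀ᵐ ω ∂P, Filter.Tendsto (fun n => v n ω) Filter.atTop (𝓝 (v0 ω)))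
    (a : ℕ → Ω → ℝ) (a0 l : Ω → ℝ)
    (ha : ∀ n, Integrable (a n) P) (ha0 : Integrable a0 P) (hl : Integrable l P)
    (hθa : ∀ n, ∀ᵐ ω ∂P, θ (v n ω) ω = (a n ω : EReal))
    (hθa0 : ∀ᵐ ω ∂P, θ (v0 ω) ω = (a0 ω : EReal))
    (hd : ∀ n, Integrable (fun ω => dotB (v n ω) (yb ω)) P)
    (hd0 : Integrable (fun ω => dotB (v0 ω) (yb ω)) P)
    (hb : ∀ n, ∀ᵐ ω ∂P, dotB (v n ω) (yb ω) - l ω ≤ a n ω)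
    (hb0 : ∀ᵐ ω ∂P, dotB (v0 ω) (yb ω) - l ω ≤ a0 ω)
    (hdt : Filter.Tendsto (fun n => ∫ ω, dotB (v n ω) (yb ω) ∂P) Filter.atTop
      (𝓝 (∫ ω, dotB (v0 ω) (yb ω) ∂P)))
    (c : ℝ) (hc : ∀ n, ∫ ω, a n ω ∂P ≤ c) : ∫ ω, a0 ω ∂P ≤ c := by
  let s : ℕ → Ω → ℝ := fun n ω => a n ω - dotB (v n ω) (yb ω) + l ω
  let s0 : Ω → ℝ := fun ω => a0 ω - dotB (v0 ω) (yb ω) + l ω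
  have hs : ∀ n, Integrable (s n) P := fun n => ((ha n).sub (hd n)).add hl
  have hs0 : Integrable s0 P := (ha0.sub hd0).add hl
  have is : ∀ n, ∫ ω, s n ω ∂P = ∫ ω, a n ω ∂P - ∫ ω, dotB (v n ω) (yb ω) ∂P + ∫ ω, l ω ∂P := by
    intro n
    rw [← integral_sub (ha n) (hd n)]
    exact integral_add ((ha n).sub (hd n)) hl
  have is0 : ∫ ω, s0 ω ∂P = ∫ ω, a0 ω ∂P - ∫ ω, dotB (v0 ω) (yb ω) ∂P + ∫ ω, l ω ∂P := by
    rw [← integral_sub ha0 hd0]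
    exact integral_add (ha0.sub hd0) hl
  have hpt : ∀ᵐ ω ∂P, ENNReal.ofReal (s0 ω) ≤
      Filter.liminf (fun n => ENNReal.ofReal (s n ω)) Filter.atTop := by
    filter_upwards [hv, ae_all_iff.2 hθa, hθa0] with ω h1 h2 h3
    have hdc : Continuous fun z : Fin (T+1) → Fin d → ℝ => dotB z (yb ω) := by
      unfold dotB dotd; fun_prop
    have h4 := (hdc.tendsto (v0 ω)).comp h1
    refine le_of_forall_lt fun b hbb => ?_
    obtain ⟨b', hb1, hb2⟩ := exists_between hbb
    refine hb1.trans_le (Filter.le_liminf_of_le (by isBoundedDefault) ?_)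
    have hbt : b' ≠ ⊤ := hb2.ne_top
    have hb3 := (ENNReal.lt_ofReal_iff_toReal_lt hbt).1 hb2
    let δ := (s0 ω - b'.toReal) / 2
    have hδ : 0 < δ := by simp only [δ]; linarith
    have e1 : ∀ᶠ n in Filter.atTop, a0 ω - δ < a n ω := by
      have := h1.eventually (hθ_lsc ω (v0 ω) ((a0 ω - δ : ℝ) : EReal) (by
        simp only [h3]; exact EReal.coe_lt_coe_iff.2 (by linarith)))
      filter_upwards [this] with n hn
      rw [h2 n] at hn
      exact EReal.coe_lt_coe_iff.1 hn
    have e2 : ∀ᶠ n in Filter.atTop, dotB (v n ω) (yb ω) < dotB (v0 ω) (yb ω) + δ :=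
      h4.eventually (gt_mem_nhds (by linarith))
    filter_upwards [e1, e2] with n f1 f2
    refine ((ENNReal.lt_ofReal_iff_toReal_lt hbt).2 ?_).le
    simp only [s]
    have : δ + δ = s0 ω - b'.toReal := by simp only [δ]; ring
    simp only [s0] at this
    linarith
  have hF : ∫⁻ ω, ENNReal.ofReal (s0 ω) ∂P ≤
      ENNReal.ofReal (c - ∫ ω, dotB (v0 ω) (yb ω) ∂P + ∫ ω, l ω ∂P) := by
    refine (lintegral_mono_ae hpt).trans ?_
    refine (lintegral_liminf_le' fun n =>
      (hs n).aestronglyMeasurable.aemeasurable.ennreal_ofReal).trans ?_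
    have ht : Filter.Tendsto (fun n => ENNReal.ofReal
        (c - ∫ ω, dotB (v n ω) (yb ω) ∂P + ∫ ω, l ω ∂P)) Filter.atTop
        (𝓝 (ENNReal.ofReal (c - ∫ ω, dotB (v0 ω) (yb ω) ∂P + ∫ ω, l ω ∂P))) :=
      ENNReal.tendsto_ofReal ((tendsto_const_nhds.sub hdt).add tendsto_const_nhds)
    rw [← ht.liminf_eq]
    refine Filter.liminf_le_liminf (Filter.Eventually.of_forall fun n => ?_)
    rw [← ofReal_integral_eq_lintegral_ofReal (hs n) ?_]
    · refine ENNReal.ofReal_le_ofReal ?_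
      rw [is]; have := hc n; linarith
    · filter_upwards [hb n] with ω hω
      simp only [s, Pi.zero_apply]; linarith
  have hnn : 0 ≤ᵐ[P] s0 := by
    filter_upwards [hb0] with ω hω
    simp only [s0, Pi.zero_apply]; linarith
  rw [← ofReal_integral_eq_lintegral_ofReal hs0 hnn] at hF
  have h0 : 0 ≤ c - ∫ ω, dotB (v0 ω) (yb ω) ∂P + ∫ ω, l ω ∂P := by
    have hm := tendsto_const_nhds (x := c) |>.sub hdt |>.add (tendsto_const_nhds (x := ∫ ω, l ω ∂P))
    refine ge_of_tendsto' hm fun n => ?_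
    have : 0 ≤ ∫ ω, s n ω ∂P := integral_nonneg_of_ae (by
      filter_upwards [hb n] with ω hω
      simp only [s, Pi.zero_apply]; linarith)
    rw [is] at this
    have := hc n
    linarith
  have := (ENNReal.ofReal_le_ofReal_iff h0).1 hF
  rw [is0] at this
  linarith


theorem dotB_add_left {T d : ℕ} (a b c : Fin (T+1) → Fin d → ℝ) :
    dotB (a + b) c = dotB a c + dotB b c := by
  simp [dotB, dotd_add_left, Finset.sum_add_distrib]

theorem dotB_smul_left {T d : ℕ} (r : ℝ) (a c : Fin (T+1) → Fin d → ℝ) :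
    dotB (r • a) c = r * dotB a c := by
  simp [dotB, dotd_smul_left, Finset.mul_sum]

theorem dotB_sub_left {T d : ℕ} (a b c : Fin (T+1) → Fin d → ℝ) :
    dotB (a - b) c = dotB a c - dotB b c := by
  simp [dotB, dotd_sub_left, Finset.sum_sub_distrib]

theorem pairL {Ω : Type} {mΩ : MeasurableSpace Ω} {T d : ℕ} (P : Measure Ω)
    (𝓤 : Submodule ℝ (Ω → Fin (T+1) → Fin d → ℝ)) (y : Ω → Fin (T+1) → Fin d → ℝ)
    (hp : ∀ u ∈ 𝓤, Integrable (fun ω => dotB (u ω) (y ω)) P) :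
    ∃ g : 𝓤 →ₗ[ℝ] ℝ, ∀ h : 𝓤, g h = pairB P (h : Ω → Fin (T+1) → Fin d → ℝ) y := by
  refine ⟨{ toFun := fun h => pairB P (h : Ω → Fin (T+1) → Fin d → ℝ) y
            map_add' := ?_, map_smul' := ?_ }, fun h => rfl⟩
  · intro h k
    unfold pairB
    rw [← integral_add (hp _ h.2) (hp _ k.2)]
    refine integral_congr_ae (Filter.Eventually.of_forall fun ω => ?_)
    exact dotB_add_left _ _ _
  · intro r h
    unfold pairB
    rw [smul_eq_mul, ← integral_const_mul]
    refine integral_congr_ae (Filter.Eventually.of_forall fun ω => ?_)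
    exact dotB_smul_left _ _ _

theorem sublevel_convex {E : Type*} [AddCommGroup E] [Module ℝ E] (q : E → ℝ)
    (hq : ∀ (a b : ℝ) (x y : E), 0 < a → 0 < b → a + b = 1 →
      q (a • x + b • y) ≤ a * q x + b * q y) (c : ℝ) : Convex ℝ {x | q x ≤ c} := by
  rw [convex_iff_forall_pos]
  intro x hx y hy a b ha hb hab
  have h1 : a * q x ≤ a * c := mul_le_mul_of_nonneg_left hx ha.le
  have h2 : b * q y ≤ b * c := mul_le_mul_of_nonneg_left hy hb.le
  have h3 := hq a b x y ha hb hab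
  show q _ ≤ c
  have : a * c + b * c = c := by rw [← add_mul, hab, one_mul]
  linarith

theorem l1_nhds {Ω : Type} {mΩ : MeasurableSpace Ω} {T d : ℕ} (P : Measure Ω)
    (𝓤 𝓨 : Submodule ℝ (Ω → Fin (T+1) → Fin d → ℝ))
    (h𝓤meas : ∀ u ∈ 𝓤, Measurable u)
    (h𝓨dec : DecomposableB P (𝓨 : Set (Ω → Fin (T+1) → Fin d → ℝ)))
    (hpair : ∀ u ∈ 𝓤, ∀ y ∈ 𝓨, Integrable (fun ω => dotB (u ω) (y ω)) P)
    (hcoord : ∀ u ∈ 𝓤, ∀ t i, Integrable (fun ω => u ω t i) P)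
    [τ : TopologicalSpace ↥𝓤]
    (hτ_barrel : ∀ S : Set ↥𝓤, IsClosed S → Convex ℝ S → Absorbent ℝ S → S ∈ 𝓝 (0 : 𝓤))
    (hτ_compat : ∀ g : ↥𝓤 →ₗ[ℝ] ℝ, (Continuous g) ↔
      ∃ y ∈ 𝓨, ∀ u : ↥𝓤, g u = pairB P (u : Ω → Fin (T+1) → Fin d → ℝ) y) (ε : ℝ) (hε : 0 < ε) :
    {h : 𝓤 | ∫ ω, ∑ t, ∑ i, |(h : Ω → Fin (T+1) → Fin d → ℝ) ω t i| ∂P ≤ ε} ∈ 𝓝 (0 : 𝓤) := by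
  let q : 𝓤 → ℝ := fun h => ∫ ω, ∑ t, ∑ i, |(h : Ω → Fin (T+1) → Fin d → ℝ) ω t i| ∂P
  have hqi : ∀ h : 𝓤, Integrable (fun ω => ∑ t, ∑ i, |(h : Ω → Fin (T+1) → Fin d → ℝ) ω t i|) P :=
    fun h => integrable_finsetSum _ fun t _ => integrable_finsetSum _ fun i _ =>
      (hcoord _ h.2 t i).abs
  have hqc : ∀ (a b : ℝ) (x y : 𝓤), 0 < a → 0 < b → a + b = 1 →
      q (a • x + b • y) ≤ a * q x + b * q y := by
    intro a b x y ha hb hab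
    simp only [q]
    rw [← integral_const_mul, ← integral_const_mul,
      ← integral_add ((hqi x).const_mul a) ((hqi y).const_mul b)]
    refine integral_mono (hqi _) (((hqi x).const_mul a).add ((hqi y).const_mul b)) fun ω => ?_
    simp only [Pi.add_apply, Finset.mul_sum, ← Finset.sum_add_distrib]
    refine Finset.sum_le_sum fun t _ => Finset.sum_le_sum fun i _ => ?_
    simp only [Submodule.coe_add, Submodule.coe_smul, Pi.add_apply, Pi.smul_apply, smul_eq_mul]
    refine (abs_add_le _ _).trans (le_of_eq ?_)
    rw [abs_mul, abs_mul, abs_of_pos ha, abs_of_pos hb]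
  refine hτ_barrel _ ?_ (sublevel_convex q hqc ε) (absorbent_convex q hqc ε (by simp [q, hε]))
  let Bd : Set (Ω → Fin (T+1) → Fin d → ℝ) := {s | Measurable s ∧ ∀ ω t i, |s ω t i| ≤ 1}
  have hBd : ∀ s ∈ Bd, s ∈ 𝓨 := fun s hs => dec_bdd P 𝓨 h𝓨dec s hs.1 1 hs.2
  have heq : {h : 𝓤 | ∫ ω, ∑ t, ∑ i, |(h : Ω → Fin (T+1) → Fin d → ℝ) ω t i| ∂P ≤ ε} =
      ⋂ s ∈ Bd, {h : 𝓤 | pairB P (h : Ω → Fin (T+1) → Fin d → ℝ) s ≤ ε} := by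
    ext h
    simp only [Set.mem_iInter, Set.mem_ofPred_eq]
    constructor
    · intro hh s hs
      refine le_trans ?_ hh
      refine integral_mono (hpair _ h.2 _ (hBd s hs)) (hqi h) fun ω => ?_
      simp only [dotB, dotd]
      refine Finset.sum_le_sum fun t _ => Finset.sum_le_sum fun i _ => ?_
      refine (le_abs_self _).trans ?_
      rw [abs_mul]
      exact mul_le_of_le_one_right (abs_nonneg _) (hs.2 ω t i)
    · intro hh
      have := hh (fun ω t i => if 0 ≤ (h : Ω → Fin (T+1) → Fin d → ℝ) ω t i then 1 else -1) (by
        refine ⟨?_, ?_⟩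
        · refine measurable_pi_iff.2 fun t => measurable_pi_iff.2 fun i => ?_
          have hm := h𝓤meas _ h.2
          have hm' : Measurable fun ω => (h : Ω → Fin (T+1) → Fin d → ℝ) ω t i := by fun_prop
          exact Measurable.ite (measurableSet_le measurable_const hm') measurable_const
            measurable_const
        · intro ω t i
          simp only
          split_ifs <;> simp)
      refine le_trans (le_of_eq ?_) this
      refine integral_congr_ae (Filter.Eventually.of_forall fun ω => ?_)
      simp only [dotB, dotd]
      refine Finset.sum_congr rfl fun t _ => Finset.sum_congr rfl fun i _ => ?_
      split_ifs with h0
      · rw [mul_one, abs_of_nonneg h0]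
      · rw [abs_of_neg (not_le.1 h0)]; ring
  rw [heq]
  refine isClosed_biInter fun s hs => ?_
  obtain ⟨g, hg⟩ := pairL P 𝓤 s fun u hu => hpair u hu s (hBd s hs)
  have hc : Continuous g := (hτ_compat g).2 ⟨s, hBd s hs, hg⟩
  have : {h : 𝓤 | pairB P (h : Ω → Fin (T+1) → Fin d → ℝ) s ≤ ε} = {h | g h ≤ ε} := by
    ext h; simp [hg]
  rw [this]
  exact isClosed_le hc continuous_const


theorem ae_conv {Ω : Type} {mΩ : MeasurableSpace Ω} {T d : ℕ} (P : Measure Ω)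
    (w : ℕ → Ω → Fin (T+1) → Fin d → ℝ) (hw : ∀ n t i, Integrable (fun ω => w n ω t i) P)
    (h : ∀ n, ∫ ω, ∑ t, ∑ i, |w n ω t i| ∂P ≤ (1/2 : ℝ)^n) :
    ∀ᵐ ω ∂P, Filter.Tendsto (fun n => w n ω) Filter.atTop (𝓝 0) := by
  have hi : ∀ n, Integrable (fun ω => ∑ t, ∑ i, |w n ω t i|) P := fun n =>
    integrable_finsetSum _ fun t _ => integrable_finsetSum _ fun i _ => (hw n t i).abs
  have hnn : ∀ n ω, 0 ≤ ∑ t, ∑ i, |w n ω t i| := fun n ω =>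
    Finset.sum_nonneg fun t _ => Finset.sum_nonneg fun i _ => abs_nonneg _
  have hm : ∀ n, AEMeasurable (fun ω => ENNReal.ofReal (∑ t, ∑ i, |w n ω t i|)) P := fun n =>
    (hi n).aestronglyMeasurable.aemeasurable.ennreal_ofReal
  have h1 : ∫⁻ ω, ∑' n, ENNReal.ofReal (∑ t, ∑ i, |w n ω t i|) ∂P ≠ ⊤ := by
    rw [lintegral_tsum hm]
    have h2 : ∀ n, ∫⁻ ω, ENNReal.ofReal (∑ t, ∑ i, |w n ω t i|) ∂P ≤ ENNReal.ofReal ((1/2 : ℝ)^n) := by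
      intro n
      rw [← ofReal_integral_eq_lintegral_ofReal (hi n) (Filter.Eventually.of_forall (hnn n))]
      exact ENNReal.ofReal_le_ofReal (h n)
    refine ne_top_of_le_ne_top ?_ (ENNReal.tsum_le_tsum h2)
    rw [← ENNReal.ofReal_tsum_of_nonneg (fun n => by positivity) summable_geometric_two]
    exact ENNReal.ofReal_ne_top
  have h3 := ae_lt_top' (AEMeasurable.tsum hm) h1
  filter_upwards [h3] with ω hω
  have h4 := ENNReal.tendsto_atTop_zero_of_tsum_ne_top hω.ne
  have h5 := (ENNReal.tendsto_toReal ENNReal.zero_ne_top).comp h4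
  have h6 : Filter.Tendsto (fun n => ∑ t, ∑ i, |w n ω t i|) Filter.atTop (𝓝 0) := by
    refine h5.congr fun n => ?_
    simp only [Function.comp]
    rw [ENNReal.toReal_ofReal (hnn n ω)]
  refine squeeze_zero_norm (fun n => ?_) h6
  refine (pi_norm_le_iff_of_nonneg (hnn n ω)).2 fun t => (pi_norm_le_iff_of_nonneg (hnn n ω)).2
    fun i => ?_
  refine (Finset.single_le_sum (f := fun i => |w n ω t i|) (fun _ _ => abs_nonneg _)
    (Finset.mem_univ i)).trans ?_
  exact Finset.single_le_sum (f := fun t => ∑ i, |w n ω t i|)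
    (fun _ _ => Finset.sum_nonneg fun _ _ => abs_nonneg _) (Finset.mem_univ t)

theorem theta_nhds {Ω : Type} {mΩ : MeasurableSpace Ω} {T d : ℕ} (P : Measure Ω)
    (𝓤 𝓨 : Submodule ℝ (Ω → Fin (T+1) → Fin d → ℝ))
    (h𝓤meas : ∀ u ∈ 𝓤, Measurable u) (h𝓨meas : ∀ y ∈ 𝓨, Measurable y)
    (h𝓨dec : DecomposableB P (𝓨 : Set (Ω → Fin (T+1) → Fin d → ℝ)))
    (hpair : ∀ u ∈ 𝓤, ∀ y ∈ 𝓨, Integrable (fun ω => dotB (u ω) (y ω)) P)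
    (hcoord : ∀ u ∈ 𝓤, ∀ t i, Integrable (fun ω => u ω t i) P)
    [τ : TopologicalSpace ↥𝓤] [IsTopologicalAddGroup ↥𝓤]
    (hτ_barrel : ∀ S : Set ↥𝓤, IsClosed S → Convex ℝ S → Absorbent ℝ S → S ∈ 𝓝 (0 : 𝓤))
    (hτ_compat : ∀ g : ↥𝓤 →ₗ[ℝ] ℝ, (Continuous g) ↔
      ∃ y ∈ 𝓨, ∀ u : ↥𝓤, g u = pairB P (u : Ω → Fin (T+1) → Fin d → ℝ) y)
    (θ : (Fin (T+1) → Fin d → ℝ) → Ω → EReal)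
    (hθ_meas : Measurable (fun p : (Fin (T+1) → Fin d → ℝ) × Ω => θ p.1 p.2))
    (hθ_lsc : ∀ ω, LowerSemicontinuous (fun z => θ z ω))
    (hθ_convex : ∀ (ω : Ω) (a b : ℝ) (z₁ z₂ : Fin (T+1) → Fin d → ℝ),
      0 < a → 0 < b → a + b = 1 →
      θ (a • z₁ + b • z₂) ω ≤ (a : EReal) * θ z₁ ω + (b : EReal) * θ z₂ ω)
    (hEθ_fin : ∀ u ∈ 𝓤, ∃ r : ℝ, EE P (fun ω => θ (u ω) ω) = (r : EReal))
    (yb : Ω → Fin (T+1) → Fin d → ℝ) (hyb : yb ∈ 𝓨) (hEs : EE P (fun ω =>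
        ⨆ z : Fin (T+1) → Fin d → ℝ, (((dotB z (yb ω) : ℝ) : EReal) - θ z ω)) ≠ ⊤)
    (u : Ω → Fin (T+1) → Fin d → ℝ) (hu : u ∈ 𝓤) :
    ∃ q : 𝓤 → ℝ, (∀ h : 𝓤, EE P (fun ω => θ ((u + (h : Ω → Fin (T+1) → Fin d → ℝ)) ω) ω)
      = (q h : EReal)) ∧
      (∀ (a b : ℝ) (x y : 𝓤), 0 < a → 0 < b → a + b = 1 →
        q (a • x + b • y) ≤ a * q x + b * q y) ∧
      ∃ c : ℝ, {h | q h ≤ c} ∈ 𝓝 (0 : 𝓤) := by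
  have hA : ∀ v ∈ 𝓤, Integrable (fun ω => (θ (v ω) ω).toReal) P ∧
      ∀ᵐ ω ∂P, θ (v ω) ω = ((θ (v ω) ω).toReal : EReal) := by
    intro v hv
    obtain ⟨r, hr⟩ := hEθ_fin v hv
    exact EE_real (hθ_meas.comp ((h𝓤meas v hv).prodMk measurable_id))
      (by rw [hr]; exact EReal.coe_ne_top _) (by rw [hr]; exact EReal.coe_ne_bot _)
  -- integrable bound
  obtain ⟨l, hl, hlb⟩ : ∃ l : Ω → ℝ, Integrable l P ∧ ∀ v ∈ 𝓤, ∀ᵐ ω ∂P,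
      dotB (v ω) (yb ω) - l ω ≤ (θ (v ω) ω).toReal := by
    obtain ⟨m, hm1, hm2, hm3⟩ := meas_minorant P (fun ω => epos (⨆ z : Fin (T+1) → Fin d → ℝ,
      (((dotB z (yb ω) : ℝ) : EReal) - θ z ω))) (by
        intro h
        apply hEs
        unfold EE
        rw [if_pos h])
    refine ⟨fun ω => (m ω).toReal, integrable_toReal_of_lintegral_ne_top hm1.aemeasurable hm2,
      fun v hv => ?_⟩
    have hv1 := h𝓤meas v hv
    have hy1 := h𝓨meas yb hyb
    have hdm : Measurable fun ω => dotB (v ω) (yb ω) := by unfold dotB dotd; fun_prop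
    have hθm : Measurable fun ω => (θ (v ω) ω).toReal :=
      measurable_ereal_toReal.comp (hθ_meas.comp (hv1.prodMk measurable_id))
    have h1 := hm3 (fun ω => ENNReal.ofReal (dotB (v ω) (yb ω) - (θ (v ω) ω).toReal))
      (hdm.sub hθm).ennreal_ofReal (by
        filter_upwards [(hA v hv).2] with ω hω
        rw [← epos_coe]
        refine epos_mono ?_
        refine le_trans (le_of_eq ?_) (le_iSup _ (v ω))
        rw [EReal.coe_sub, ← hω])
    filter_upwards [h1, ae_lt_top hm1 hm2] with ω a b
    have := (ENNReal.ofReal_le_iff_le_toReal b.ne).1 a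
    linarith
  let q : 𝓤 → ℝ := fun h => ∫ ω, (θ ((u + (h : Ω → Fin (T+1) → Fin d → ℝ)) ω) ω).toReal ∂P
  have hmem : ∀ h : 𝓤, u + (h : Ω → Fin (T+1) → Fin d → ℝ) ∈ 𝓤 := fun h => 𝓤.add_mem hu h.2
  have hqc : ∀ (a b : ℝ) (x y : 𝓤), 0 < a → 0 < b → a + b = 1 →
        q (a • x + b • y) ≤ a * q x + b * q y := by
    intro a b x y ha hb hab
    simp only [q]
    obtain ⟨i1, r1⟩ := hA _ (hmem x)
    obtain ⟨i2, r2⟩ := hA _ (hmem y)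
    obtain ⟨i3, r3⟩ := hA _ (hmem (a • x + b • y))
    rw [← integral_const_mul, ← integral_const_mul,
      ← integral_add (i1.const_mul a) (i2.const_mul b)]
    refine integral_mono_ae i3 ((i1.const_mul a).add (i2.const_mul b)) ?_
    filter_upwards [r1, r2, r3] with ω a1 a2 a3
    have e : (u + ((a • x + b • y : 𝓤) : Ω → Fin (T+1) → Fin d → ℝ)) ω =
        a • ((u + (x : Ω → Fin (T+1) → Fin d → ℝ)) ω) +
          b • ((u + (y : Ω → Fin (T+1) → Fin d → ℝ)) ω) := by
      have hb' : b = 1 - a := by linarith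
      subst hb'
      ext t i
      simp only [Submodule.coe_add, Submodule.coe_smul, Pi.add_apply, Pi.smul_apply, smul_eq_mul]
      ring
    have := hθ_convex ω a b ((u + (x : Ω → Fin (T+1) → Fin d → ℝ)) ω)
      ((u + (y : Ω → Fin (T+1) → Fin d → ℝ)) ω) ha hb hab
    rw [← e, a1, a2, a3, ← EReal.coe_mul, ← EReal.coe_mul, ← EReal.coe_add,
      EReal.coe_le_coe_iff] at this
    exact this
  refine ⟨q, fun h => EE_congr_coe (hA _ (hmem h)).1 (hA _ (hmem h)).2, hqc, q 0 + 1, ?_⟩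
  refine hτ_barrel _ ?_ (sublevel_convex q hqc _) (absorbent_convex q hqc _ (by linarith))
  refine isClosed_of_closure_subset fun h0 hh0 => ?_
  rw [mem_closure_iff_nhds] at hh0
  obtain ⟨g, hg⟩ := pairL P 𝓤 yb fun u hu => hpair u hu yb hyb
  have hgc : Continuous g := (hτ_compat g).2 ⟨yb, hyb, hg⟩
  have hW : ∀ n : ℕ, ∃ h : 𝓤, q h ≤ q 0 + 1 ∧
      ∫ ω, ∑ t, ∑ i, |((h - h0 : 𝓤) : Ω → Fin (T+1) → Fin d → ℝ) ω t i| ∂P ≤ (1/2 : ℝ)^n ∧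
      |g h - g h0| < (1/2 : ℝ)^n := by
    intro n
    have hn : (0 : ℝ) < (1/2)^n := by positivity
    have h1 := l1_nhds P 𝓤 𝓨 h𝓤meas h𝓨dec hpair hcoord hτ_barrel hτ_compat _ hn
    have h2 : Filter.Tendsto (fun h : 𝓤 => h - h0) (𝓝 h0) (𝓝 0) := by
      have hc : Continuous (fun h : 𝓤 => h - h0) := continuous_id.sub continuous_const
      have := hc.tendsto h0
      rwa [sub_self] at this
    have h3 := h2 h1
    have h4 : {h : 𝓤 | |g h - g h0| < (1/2 : ℝ)^n} ∈ 𝓝 h0 := by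
      have := (hgc.tendsto h0) (Metric.ball_mem_nhds _ hn)
      exact this
    obtain ⟨h, ⟨a, b⟩, c⟩ := hh0 _ (Filter.inter_mem h3 h4)
    exact ⟨h, c, a, b⟩
  choose hs hs1 hs2 hs3 using hW
  have hconv := ae_conv P (fun n => ((hs n - h0 : 𝓤) : Ω → Fin (T+1) → Fin d → ℝ))
    (fun n t i => hcoord _ (hs n - h0).2 t i) hs2
  have hpow : Filter.Tendsto (fun n : ℕ => (1/2 : ℝ)^n) Filter.atTop (𝓝 0) :=
    tendsto_pow_atTop_nhds_zero_of_lt_one (by norm_num) (by norm_num)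
  refine theta_fatou P θ hθ_lsc (fun n => u + (hs n : Ω → Fin (T+1) → Fin d → ℝ))
    (u + (h0 : Ω → Fin (T+1) → Fin d → ℝ)) yb ?_ _ _ l (fun n => (hA _ (hmem (hs n))).1)
    (hA _ (hmem h0)).1 hl (fun n => (hA _ (hmem (hs n))).2) (hA _ (hmem h0)).2
    (fun n => hpair _ (hmem _) _ hyb) (hpair _ (hmem _) _ hyb)
    (fun n => hlb _ (hmem _)) (hlb _ (hmem _)) ?_ _ hs1
  · filter_upwards [hconv] with ω hω
    have := hω.add_const ((u + (h0 : Ω → Fin (T+1) → Fin d → ℝ)) ω)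
    rw [zero_add] at this
    refine this.congr fun n => ?_
    simp only [Submodule.coe_sub, Pi.add_apply, Pi.sub_apply]
    abel
  · have e : ∀ h : 𝓤, ∫ ω, dotB ((u + (h : Ω → Fin (T+1) → Fin d → ℝ)) ω) (yb ω) ∂P
        = pairB P u yb + g h := by
      intro h
      rw [hg]
      unfold pairB
      rw [← integral_add (hpair _ hu _ hyb) (hpair _ h.2 _ hyb)]
      refine integral_congr_ae (Filter.Eventually.of_forall fun ω => ?_)
      exact dotB_add_left _ _ _
    simp only [e]
    refine Filter.Tendsto.const_add _ ?_
    rw [tendsto_iff_dist_tendsto_zero]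
    exact squeeze_zero (fun n => dist_nonneg) (fun n => (hs3 n).le) hpow


theorem deltaX_comb {T d : ℕ} (x x' : Fin (T+1) → Fin d → ℝ) (a b : ℝ) (t : Fin (T+1)) :
    deltaX (a • x + b • x') t = a • deltaX x t + b • deltaX x' t := by
  unfold deltaX
  split_ifs
  · simp
  · simp only [Pi.add_apply, Pi.smul_apply, smul_sub]; abel

theorem intFB_convex {Ω : Type} {mΩ : MeasurableSpace Ω} (P : Measure Ω)
    {T d : ℕ} (ℱ : Fin (T+1) → MeasurableSpace Ω)
    (hℱ_le : ∀ t, ℱ t ≤ mΩ) (hℱ_mono : Monotone ℱ)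
    (K : Fin (T+1) → (Fin d → ℝ) → (Fin d → ℝ) → Ω → EReal)
    (hK_meas : ∀ t, @Measurable (((Fin d → ℝ) × (Fin d → ℝ)) × Ω) EReal
      (MeasurableSpace.prod inferInstance (ℱ t)) _ (fun p => K t p.1.1 p.1.2 p.2))
    (hK : ∀ t ω, (∀ x u, K t x u ω ≠ ⊥))
    (hK_convex : ∀ (t : Fin (T+1)) (ω : Ω) (a b : ℝ) (x₁ x₂ u₁ u₂ : Fin d → ℝ),
      0 < a → 0 < b → a + b = 1 →
      K t (a • x₁ + b • x₂) (a • u₁ + b • u₂) ω ≤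
        (a : EReal) * K t x₁ u₁ ω + (b : EReal) * K t x₂ u₂ ω)
    (x₁ x₂ u₁ u₂ : Ω → Fin (T+1) → Fin d → ℝ) (hx₁ : x₁ ∈ NBolza d ℱ) (hx₂ : x₂ ∈ NBolza d ℱ)
    (hu₁ : u₁ ∈ NBolza d ℱ) (hu₂ : u₂ ∈ NBolza d ℱ) (a b r₁ r₂ : ℝ)
    (ha : 0 < a) (hb : 0 < b) (hab : a + b = 1)
    (h1 : intFB P K x₁ u₁ = (r₁ : EReal)) (h2 : intFB P K x₂ u₂ = (r₂ : EReal)) :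
    intFB P K (a • x₁ + b • x₂) (a • u₁ + b • u₂) ≤ ((a * r₁ + b * r₂ : ℝ) : EReal) := by
  obtain ⟨i1, q1⟩ := EE_real (meas_fB ℱ hℱ_le hℱ_mono K hK_meas x₁ u₁ hx₁ hu₁)
    (by change intFB P K x₁ u₁ ≠ ⊤; rw [h1]; exact EReal.coe_ne_top _)
    (by change intFB P K x₁ u₁ ≠ ⊥; rw [h1]; exact EReal.coe_ne_bot _)
  obtain ⟨i2, q2⟩ := EE_real (meas_fB ℱ hℱ_le hℱ_mono K hK_meas x₂ u₂ hx₂ hu₂)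
    (by change intFB P K x₂ u₂ ≠ ⊤; rw [h2]; exact EReal.coe_ne_top _)
    (by change intFB P K x₂ u₂ ≠ ⊥; rw [h2]; exact EReal.coe_ne_bot _)
  have e1 : r₁ = ∫ ω, (fBolza K (x₁ ω) (u₁ ω) ω).toReal ∂P := by
    have := EE_congr_coe i1 q1
    unfold intFB at h1
    rw [h1] at this
    exact_mod_cast this
  have e2 : r₂ = ∫ ω, (fBolza K (x₂ ω) (u₂ ω) ω).toReal ∂P := by
    have := EE_congr_coe i2 q2
    unfold intFB at h2
    rw [h2] at this
    exact_mod_cast this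
  have e3 : a * r₁ + b * r₂ = ∫ ω, (a * (fBolza K (x₁ ω) (u₁ ω) ω).toReal +
      b * (fBolza K (x₂ ω) (u₂ ω) ω).toReal) ∂P := by
    rw [integral_add (i1.const_mul a) (i2.const_mul b), integral_const_mul, integral_const_mul,
      e1, e2]
  rw [e3]
  refine (EE_mono ?_).trans_eq (EE_coe ((i1.const_mul a).add (i2.const_mul b)))
  filter_upwards [q1, q2] with ω w1 w2
  obtain ⟨a1, a2⟩ := fB_real K hK (x₁ ω) (u₁ ω) ω (by rw [w1]; exact EReal.coe_ne_top _)
  obtain ⟨b1, b2⟩ := fB_real K hK (x₂ ω) (u₂ ω) ω (by rw [w2]; exact EReal.coe_ne_top _)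
  simp only [Pi.add_apply]
  rw [a2, b2, Finset.mul_sum, Finset.mul_sum, ← Finset.sum_add_distrib, ← ereal_sum_coe]
  unfold fBolza
  refine Finset.sum_le_sum fun t _ => ?_
  have := hK_convex t ω a b (x₁ ω t) (x₂ ω t) (deltaX (x₁ ω) t + u₁ ω t)
    (deltaX (x₂ ω) t + u₂ ω t) ha hb hab
  rw [a1, b1, ← EReal.coe_mul, ← EReal.coe_mul, ← EReal.coe_add] at this
  refine le_trans (le_of_eq ?_) this
  have e := deltaX_comb (x₁ ω) (x₂ ω) a b t
  have e' : deltaX (a • x₁ ω + b • x₂ ω) t + (a • u₁ ω t + b • u₂ ω t) =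
    a • (deltaX (x₁ ω) t + u₁ ω t) + b • (deltaX (x₂ ω) t + u₂ ω t) := by
    rw [e, smul_add, smul_add]; abel
  rw [← e']
  rfl

theorem linear_cont {E : Type*} [AddCommGroup E] [Module ℝ E] [TopologicalSpace E]
    [IsTopologicalAddGroup E] [ContinuousSMul ℝ E] (g : E →ₗ[ℝ] ℝ) (c : ℝ)
    (h : {x | g x ≤ c} ∈ 𝓝 (0 : E)) : Continuous g := by
  have h0 : 0 ≤ c := by have := mem_of_mem_nhds h; simpa using this
  refine continuous_of_continuousAt_zero g ?_
  have h1 : {x | |g x| ≤ c} ∈ 𝓝 (0 : E) := by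
    have : (fun x : E => -x) ⁻¹' {x | g x ≤ c} ∈ 𝓝 (0 : E) :=
      continuous_neg.continuousAt.preimage_mem_nhds (by rwa [neg_zero])
    filter_upwards [h, this] with x a b
    have b' : g (-x) ≤ c := b
    rw [map_neg] at b'
    exact abs_le.2 ⟨by linarith, a⟩
  rw [ContinuousAt, map_zero, Metric.tendsto_nhds]
  intro ε hε
  have h2 : (fun x : E => ((c + 1) / ε) • x) ⁻¹' {x | |g x| ≤ c} ∈ 𝓝 (0 : E) :=
    (continuous_const_smul _).continuousAt.preimage_mem_nhds (by rwa [smul_zero])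
  filter_upwards [h2] with x hx
  have hx' : |g (((c + 1) / ε) • x)| ≤ c := hx
  have hp : 0 < (c + 1) / ε := by positivity
  rw [map_smul, smul_eq_mul, abs_mul, abs_of_pos hp] at hx'
  rw [Real.dist_eq, sub_zero]
  have : (c+1) * |g x| ≤ c * ε := by
    have := mul_le_mul_of_nonneg_right hx' hε.le
    have e : (c + 1) / ε * |g x| * ε = (c+1) * |g x| := by field_simp
    linarith
  nlinarith [abs_nonneg (g x)]

theorem phi_convex {Ω : Type} {mΩ : MeasurableSpace Ω} (P : Measure Ω)
    {T d : ℕ} (ℱ : Fin (T+1) → MeasurableSpace Ω)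
    (hℱ_le : ∀ t, ℱ t ≤ mΩ) (hℱ_mono : Monotone ℱ)
    (K : Fin (T+1) → (Fin d → ℝ) → (Fin d → ℝ) → Ω → EReal)
    (hK_meas : ∀ t, @Measurable (((Fin d → ℝ) × (Fin d → ℝ)) × Ω) EReal
      (MeasurableSpace.prod inferInstance (ℱ t)) _ (fun p => K t p.1.1 p.1.2 p.2))
    (hK : ∀ t ω, (∀ x u, K t x u ω ≠ ⊥))
    (hK_convex : ∀ (t : Fin (T+1)) (ω : Ω) (a b : ℝ) (x₁ x₂ u₁ u₂ : Fin d → ℝ),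
      0 < a → 0 < b → a + b = 1 →
      K t (a • x₁ + b • x₂) (a • u₁ + b • u₂) ω ≤
        (a : EReal) * K t x₁ u₁ ω + (b : EReal) * K t x₂ u₂ ω)
    (u₁ u₂ : Ω → Fin (T+1) → Fin d → ℝ)
    (hu₁ : u₁ ∈ NBolza d ℱ) (hu₂ : u₂ ∈ NBolza d ℱ) (a b p₁ p₂ p₃ : ℝ)
    (ha : 0 < a) (hb : 0 < b) (hab : a + b = 1)
    (h1 : phiB P K ℱ u₁ = (p₁ : EReal)) (h2 : phiB P K ℱ u₂ = (p₂ : EReal))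
    (h3 : phiB P K ℱ (a • u₁ + b • u₂) = (p₃ : EReal)) :
    p₃ ≤ a * p₁ + b * p₂ := by
  refine le_of_forall_pos_le_add fun ε hε => ?_
  have key : ∀ (v : Ω → Fin (T+1) → Fin d → ℝ) (p : ℝ), phiB P K ℱ v = (p : EReal) →
      ∃ x ∈ NBolza d ℱ, ∃ r : ℝ, intFB P K x v = (r : EReal) ∧ r ≤ p + ε := by
    intro v p hp
    have : phiB P K ℱ v < ((p + ε : ℝ) : EReal) := by
      rw [hp]; exact_mod_cast (by linarith : p < p + ε)
    unfold phiB at this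
    simp only [iInf_lt_iff] at this
    obtain ⟨x, hx, hlt⟩ := this
    have hge : phiB P K ℱ v ≤ intFB P K x v := iInf₂_le x hx
    rw [hp] at hge
    refine ⟨x, hx, (intFB P K x v).toReal, ?_, ?_⟩
    · exact (EReal.coe_toReal hlt.ne_top (fun h => by simp [h] at hge)).symm
    · rw [← EReal.coe_le_coe_iff, EReal.coe_toReal hlt.ne_top (fun h => by simp [h] at hge)]
      exact hlt.le
  obtain ⟨x₁, hx₁, r₁, e₁, l₁⟩ := key u₁ p₁ h1
  obtain ⟨x₂, hx₂, r₂, e₂, l₂⟩ := key u₂ p₂ h2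
  have hh := intFB_convex P ℱ hℱ_le hℱ_mono K hK_meas hK hK_convex x₁ x₂ u₁ u₂ hx₁ hx₂ hu₁ hu₂
    a b r₁ r₂ ha hb hab e₁ e₂
  have hx₃ : a • x₁ + b • x₂ ∈ NBolza d ℱ := fun t =>
    Measurable.add (Measurable.const_smul (hx₁ t) a) (Measurable.const_smul (hx₂ t) b)
  have h4 : phiB P K ℱ (a • u₁ + b • u₂) ≤ _ := iInf₂_le _ hx₃
  have h5 := h4.trans hh
  rw [h3, EReal.coe_le_coe_iff] at h5
  nlinarith


theorem phi_subgrad {Ω : Type} {mΩ : MeasurableSpace Ω} (P : Measure Ω)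
    {T d : ℕ} (ℱ : Fin (T+1) → MeasurableSpace Ω)
    (hℱ_le : ∀ t, ℱ t ≤ mΩ) (hℱ_mono : Monotone ℱ)
    (K : Fin (T+1) → (Fin d → ℝ) → (Fin d → ℝ) → Ω → EReal)
    (hK_meas : ∀ t, @Measurable (((Fin d → ℝ) × (Fin d → ℝ)) × Ω) EReal
      (MeasurableSpace.prod inferInstance (ℱ t)) _ (fun p => K t p.1.1 p.1.2 p.2))
    (hK : ∀ t ω, (∀ x u, K t x u ω ≠ ⊥))
    (hK_convex : ∀ (t : Fin (T+1)) (ω : Ω) (a b : ℝ) (x₁ x₂ u₁ u₂ : Fin d → ℝ),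
      0 < a → 0 < b → a + b = 1 →
      K t (a • x₁ + b • x₂) (a • u₁ + b • u₂) ω ≤
        (a : EReal) * K t x₁ u₁ ω + (b : EReal) * K t x₂ u₂ ω)
    (𝓤 𝓨 : Submodule ℝ (Ω → Fin (T+1) → Fin d → ℝ))
    [τ : TopologicalSpace ↥𝓤] [IsTopologicalAddGroup ↥𝓤] [ContinuousSMul ℝ ↥𝓤]
    (hτ_compat : ∀ g : ↥𝓤 →ₗ[ℝ] ℝ, (Continuous g) ↔
      ∃ y ∈ 𝓨, ∀ u : ↥𝓤, g u = pairB P (u : Ω → Fin (T+1) → Fin d → ℝ) y)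
    (hφ : ∀ u ∈ 𝓤, phiB P K ℱ u ≠ ⊥)
    (θ : (Fin (T+1) → Fin d → ℝ) → Ω → EReal)
    (hgrowth : ∀ u ∈ 𝓤, (∀ t, Measurable[ℱ t] (fun ω => u ω t)) →
      ∃ x ∈ NBolza d ℱ, ∀ᵐ ω ∂P, fBolza K (x ω) (u ω) ω ≤ θ (u ω) ω)
    (u : Ω → Fin (T+1) → Fin d → ℝ) (hu : u ∈ 𝓤) (hua : u ∈ NBolza d ℱ)
    (q : 𝓤 → ℝ) (hq : ∀ h : 𝓤, EE P (fun ω => θ ((u + (h : Ω → Fin (T+1) → Fin d → ℝ)) ω) ω)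
      = (q h : EReal))
    (hqc : ∀ (a b : ℝ) (x y : 𝓤), 0 < a → 0 < b → a + b = 1 →
        q (a • x + b • y) ≤ a * q x + b * q y)
    (c : ℝ) (hc : {h | q h ≤ c} ∈ 𝓝 (0 : 𝓤)) :
    ∃ p : ℝ, phiB P K ℱ u = (p : EReal) ∧ ∃ y ∈ 𝓨, ∀ h ∈ 𝓤, h ∈ NBolza d ℱ →
      ((p + pairB P h y : ℝ) : EReal) ≤ phiB P K ℱ (u + h) := by
  let Ua : Submodule ℝ 𝓤 :=
    { carrier := {h | (h : Ω → Fin (T+1) → Fin d → ℝ) ∈ NBolza d ℱ}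
      add_mem' := fun {a b} ha hb t => Measurable.add (ha t) (hb t)
      zero_mem' := fun t => measurable_const
      smul_mem' := fun r a ha t => Measurable.const_smul (ha t) r }
  have hle : ∀ h : Ua, phiB P K ℱ (u + ((h : 𝓤) : Ω → Fin (T+1) → Fin d → ℝ)) ≤ (q h : EReal) := by
    intro h
    obtain ⟨x, hx, hx2⟩ := hgrowth (u + ((h : 𝓤) : Ω → Fin (T+1) → Fin d → ℝ))
      (𝓤.add_mem hu h.1.2) (fun t => Measurable.add (hua t) (h.2 t))
    rw [← hq h]
    exact (iInf₂_le x hx).trans (EE_mono hx2)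
  let p : Ua → ℝ := fun h => (phiB P K ℱ (u + ((h : 𝓤) : Ω → Fin (T+1) → Fin d → ℝ))).toReal
  have hp : ∀ h : Ua, phiB P K ℱ (u + ((h : 𝓤) : Ω → Fin (T+1) → Fin d → ℝ)) = (p h : EReal) :=
    fun h => (EReal.coe_toReal (ne_top_of_le_ne_top (EReal.coe_ne_top _) (hle h))
      (hφ _ (𝓤.add_mem hu h.1.2))).symm
  have hpq : ∀ h : Ua, p h ≤ q h := fun h => by
    have := hle h
    rw [hp] at this
    exact_mod_cast this
  have hpc : ∀ (a b : ℝ) (x y : Ua), 0 < a → 0 < b → a + b = 1 →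
        p (a • x + b • y) ≤ a * p x + b * p y := by
    intro a b x y ha hb hab
    refine phi_convex P ℱ hℱ_le hℱ_mono K hK_meas hK hK_convex _ _
      (fun t => Measurable.add (hua t) (x.2 t)) (fun t => Measurable.add (hua t) (y.2 t))
      a b _ _ _ ha hb hab (hp x) (hp y) ?_
    rw [← hp]
    congr 1
    have hb' : b = 1 - a := by linarith
    subst hb'
    ext ω t i
    simp only [Submodule.coe_add, Submodule.coe_smul, Pi.add_apply, Pi.smul_apply, smul_eq_mul]
    ring
  obtain ⟨g1, -, hg1⟩ := hb_convex (⊥ : Ua →ₗ.[ℝ] ℝ) (fun h => p h - p 0)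
    (fun a b x y ha hb hab => by
      have := hpc a b x y ha hb hab
      have e : p 0 = a * p 0 + b * p 0 := by rw [← add_mul, hab, one_mul]
      linarith)
    (fun x => by
      have hx : x = 0 := Subtype.ext ((Submodule.mem_bot ℝ).1 x.2)
      subst hx
      rw [LinearPMap.map_zero]
      simp)
  obtain ⟨G, hG1, hG2⟩ := hb_convex (⟨Ua, g1⟩ : 𝓤 →ₗ.[ℝ] ℝ) (fun h => q h - p 0)
    (fun a b x y ha hb hab => by
      have := hqc a b x y ha hb hab
      have e : p 0 = a * p 0 + b * p 0 := by rw [← add_mul, hab, one_mul]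
      linarith)
    (fun x => by
      have h1 := hg1 x
      have h2 := hpq x
      change g1 x ≤ _
      linarith)
  have hGc : Continuous G := linear_cont G (c - p 0) (by
    filter_upwards [hc] with h hh
    have hh' : q h ≤ c := hh
    have := hG2 h
    change G h ≤ c - p 0
    linarith)
  obtain ⟨y, hy, hGy⟩ := (hτ_compat G).1 hGc
  refine ⟨p 0, ?_, y, hy, fun h hh hha => ?_⟩
  · rw [← hp 0]; simp
  · let h' : Ua := ⟨⟨h, hh⟩, hha⟩
    have h1 : G (h' : 𝓤) = g1 h' := hG1 h'
    have h2 := hg1 h'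
    have h3 := hGy (h' : 𝓤)
    have h4 := hp h'
    change phiB P K ℱ (u + h) = _ at h4
    rw [h4, EReal.coe_le_coe_iff]
    change G (h' : 𝓤) = pairB P h y at h3
    linarith


theorem sel_viol {Ω : Type} {m : MeasurableSpace Ω} {d : ℕ} (μ : Measure Ω) [IsFiniteMeasure μ]
    (k : (Fin d → ℝ) → (Fin d → ℝ) → Ω → EReal)
    (hk : Measurable (fun p : ((Fin d → ℝ) × (Fin d → ℝ)) × Ω => k p.1.1 p.1.2 p.2))
    (hbot : ∀ x u ω, k x u ω ≠ ⊥)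
    (ξ η v y : Ω → Fin d → ℝ) (hξ : Measurable ξ) (hη : Measurable η) (hv : Measurable v)
    (hy : Measurable y)
    (hpos : μ {ω | ∃ p : (Fin d → ℝ) × (Fin d → ℝ), k p.1 p.2 ω < k (ξ ω) (η ω) ω +
      ((dotd (v ω) (p.1 - ξ ω) + dotd (y ω) (p.2 - η ω) : ℝ) : EReal) ∧ k (ξ ω) (η ω) ω < ⊤} ≠ 0) :
    ∃ A, MeasurableSet A ∧ μ A ≠ 0 ∧ ∃ (α β : Ω → Fin d → ℝ) (κ : Ω → ℝ) (M : ℝ),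
      Measurable α ∧ Measurable β ∧ Measurable κ ∧ (∀ ω i, |α ω i| ≤ M) ∧ (∀ ω i, |β ω i| ≤ M) ∧
      (∀ ω, |κ ω| ≤ M) ∧ (∀ ω, k (ξ ω + α ω) (η ω + β ω) ω = k (ξ ω) (η ω) ω + (κ ω : EReal)) ∧
      (∀ ω, κ ω ≤ dotd (v ω) (α ω) + dotd (y ω) (β ω)) ∧
      (∀ ω ∈ A, κ ω < dotd (v ω) (α ω) + dotd (y ω) (β ω)) := by
  have hk0 : Measurable fun ω => k (ξ ω) (η ω) ω := meas_K_aux k hk ξ η hξ hη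
  obtain ⟨A0, hA0, hμ0, s, hs, hsS⟩ := sel_main (X := (Fin d → ℝ) × (Fin d → ℝ)) μ
    {q | k q.1.1 q.1.2 q.2 < k (ξ q.2) (η q.2) q.2 +
      ((dotd (v q.2) (q.1.1 - ξ q.2) + dotd (y q.2) (q.1.2 - η q.2) : ℝ) : EReal) ∧
      k (ξ q.2) (η q.2) q.2 < ⊤} (by
        have h1 : Measurable fun q : ((Fin d → ℝ) × (Fin d → ℝ)) × Ω => k (ξ q.2) (η q.2) q.2 :=
          hk0.comp measurable_snd
        have h2 : Measurable fun q : ((Fin d → ℝ) × (Fin d → ℝ)) × Ω =>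
            (dotd (v q.2) (q.1.1 - ξ q.2) + dotd (y q.2) (q.1.2 - η q.2) : ℝ) := by
          unfold dotd
          fun_prop
        exact (measurableSet_lt hk (h1.add (measurable_coe_real_ereal.comp h2))).inter
          (measurableSet_lt h1 measurable_const)) hpos
  let α0 : Ω → Fin d → ℝ := fun ω => (s ω).1 - ξ ω
  let β0 : Ω → Fin d → ℝ := fun ω => (s ω).2 - η ω
  let κ0 : Ω → ℝ := fun ω => (k (s ω).1 (s ω).2 ω).toReal - (k (ξ ω) (η ω) ω).toReal
  have hα0 : Measurable α0 := (measurable_fst.comp hs).sub hξ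
  have hβ0 : Measurable β0 := (measurable_snd.comp hs).sub hη
  have hκ0 : Measurable κ0 := (measurable_ereal_toReal.comp
    (meas_K_aux k hk _ _ (measurable_fst.comp hs) (measurable_snd.comp hs))).sub
    (measurable_ereal_toReal.comp hk0)
  let N : Ω → ℝ := fun ω => ∑ i, |α0 ω i| + ∑ i, |β0 ω i| + |κ0 ω|
  have hN : Measurable N := by
    refine (Measurable.add ?_ ?_).add (continuous_abs.measurable.comp hκ0)
    · exact Finset.measurable_fun_sum _ fun i _ =>
        continuous_abs.measurable.comp ((measurable_pi_apply i).comp hα0)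
    · exact Finset.measurable_fun_sum _ fun i _ =>
        continuous_abs.measurable.comp ((measurable_pi_apply i).comp hβ0)
  have hn : ∃ n : ℕ, μ (A0 ∩ {ω | N ω ≤ n}) ≠ 0 := by
    by_contra! h
    apply hμ0
    refine measure_mono_null ?_ (measure_iUnion_null h)
    intro ω hω
    obtain ⟨n, hn⟩ := exists_nat_ge (N ω)
    exact Set.mem_iUnion.2 ⟨n, hω, hn⟩
  obtain ⟨n, hn⟩ := hn
  have hA : MeasurableSet (A0 ∩ {ω | N ω ≤ n}) := hA0.inter (hN measurableSet_Iic)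
  set A := A0 ∩ {ω | N ω ≤ n} with hAdef
  have hb : ∀ ω ∈ A, (∀ i, |α0 ω i| ≤ n) ∧ (∀ i, |β0 ω i| ≤ n) ∧ |κ0 ω| ≤ n := by
    intro ω hω
    have h1 : ∑ i, |α0 ω i| + ∑ i, |β0 ω i| + |κ0 ω| ≤ n := hω.2
    have h2 : 0 ≤ ∑ i, |α0 ω i| := Finset.sum_nonneg fun _ _ => abs_nonneg _
    have h3 : 0 ≤ ∑ i, |β0 ω i| := Finset.sum_nonneg fun _ _ => abs_nonneg _
    have h4 := abs_nonneg (κ0 ω)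
    refine ⟨fun i => ?_, fun i => ?_, by linarith⟩
    · have := Finset.single_le_sum (f := fun i => |α0 ω i|) (fun _ _ => abs_nonneg _)
        (Finset.mem_univ i)
      linarith
    · have := Finset.single_le_sum (f := fun i => |β0 ω i|) (fun _ _ => abs_nonneg _)
        (Finset.mem_univ i)
      linarith
  have hreal : ∀ ω ∈ A, k (ξ ω + α0 ω) (η ω + β0 ω) ω = k (ξ ω) (η ω) ω + (κ0 ω : EReal) ∧
      κ0 ω < dotd (v ω) (α0 ω) + dotd (y ω) (β0 ω) := by
    intro ω hω
    obtain ⟨h1, h2⟩ := hsS ω hω.1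
    simp only at h1 h2
    have e1 : ξ ω + α0 ω = (s ω).1 := by simp only [α0]; abel
    have e2 : η ω + β0 ω = (s ω).2 := by simp only [β0]; abel
    rw [e1, e2]
    have r1 := EReal.coe_toReal h2.ne (hbot (ξ ω) (η ω) ω)
    have r2 := EReal.coe_toReal (h1.ne_top) (hbot (s ω).1 (s ω).2 ω)
    rw [← r1, ← r2, ← EReal.coe_add, EReal.coe_lt_coe_iff] at h1
    constructor
    · rw [← r1, ← r2, ← EReal.coe_add]
      congr 1
      simp only [κ0]
      ring
    · simp only [κ0]
      have : dotd (v ω) (α0 ω) + dotd (y ω) (β0 ω) = dotd (v ω) ((s ω).1 - ξ ω) +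
        dotd (y ω) ((s ω).2 - η ω) := rfl
      linarith
  have hn0 : (0 : ℝ) ≤ n := Nat.cast_nonneg n
  have z1 : ∀ a : Fin d → ℝ, dotd a 0 = 0 := fun a => by simp [dotd]
  refine ⟨A, hA, hn, A.indicator α0, A.indicator β0, A.indicator κ0, n, hα0.indicator hA,
    hβ0.indicator hA, hκ0.indicator hA, ?_, ?_, ?_, ?_, ?_, ?_⟩
  · intro ω i
    by_cases hω : ω ∈ A
    · rw [Set.indicator_of_mem hω]; exact (hb ω hω).1 i
    · rw [Set.indicator_of_notMem hω]; simpa using hn0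
  · intro ω i
    by_cases hω : ω ∈ A
    · rw [Set.indicator_of_mem hω]; exact (hb ω hω).2.1 i
    · rw [Set.indicator_of_notMem hω]; simpa using hn0
  · intro ω
    by_cases hω : ω ∈ A
    · rw [Set.indicator_of_mem hω]; exact (hb ω hω).2.2
    · rw [Set.indicator_of_notMem hω]; simpa using hn0
  · intro ω
    by_cases hω : ω ∈ A
    · simp only [Set.indicator_of_mem hω]; exact (hreal ω hω).1
    · simp only [Set.indicator_of_notMem hω]; simp
  · intro ω
    by_cases hω : ω ∈ A
    · simp only [Set.indicator_of_mem hω]; exact (hreal ω hω).2.le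
    · simp only [Set.indicator_of_notMem hω, z1]; simp
  · intro ω hω
    simp only [Set.indicator_of_mem hω]; exact (hreal ω hω).2

theorem pull_one {Ω : Type} {m mΩ : MeasurableSpace Ω} (P : Measure Ω) [IsProbabilityMeasure P]
    (hm : m ≤ mΩ) (z w : Ω → ℝ) (hz : Measurable[m] z) (M : ℝ) (hM : ∀ ω, |z ω| ≤ M)
    (hw : Integrable w P) :
    Integrable (fun ω => z ω * w ω) P ∧ Integrable (fun ω => z ω * (P[w|m]) ω) P ∧
    ∫ ω, z ω * w ω ∂P = ∫ ω, z ω * (P[w|m]) ω ∂P := by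
  have hzs : StronglyMeasurable[m] z := hz.stronglyMeasurable
  have hzs' : AEStronglyMeasurable z P := (hzs.mono hm).aestronglyMeasurable
  have hb : ∀ᵐ ω ∂P, ‖z ω‖ ≤ M := Filter.Eventually.of_forall hM
  have i1 : Integrable (fun ω => z ω * w ω) P := hw.bdd_mul hzs' hb
  refine ⟨i1, integrable_condExp.bdd_mul hzs' hb, ?_⟩
  have h1 : P[fun ω => z ω * w ω | m] =ᵐ[P] fun ω => z ω * (P[w|m]) ω :=
    condExp_mul_of_stronglyMeasurable_left hzs i1 hw
  rw [← integral_condExp hm (f := fun ω => z ω * w ω)]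
  exact integral_congr_ae h1

theorem pull_d {Ω : Type} {m mΩ : MeasurableSpace Ω} {d : ℕ} (P : Measure Ω)
    [IsProbabilityMeasure P]
    (hm : m ≤ mΩ) (z w : Ω → Fin d → ℝ) (hz : Measurable[m] z) (M : ℝ) (hM : ∀ ω i, |z ω i| ≤ M)
    (hw : ∀ i, Integrable (fun ω => w ω i) P) :
    Integrable (fun ω => dotd (z ω) (w ω)) P ∧ Integrable (fun ω => dotd (z ω) ((P[w|m]) ω)) P ∧
    ∫ ω, dotd (z ω) (w ω) ∂P = ∫ ω, dotd (z ω) ((P[w|m]) ω) ∂P := by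
  have h := fun i => pull_one P hm (fun ω => z ω i) (fun ω => w ω i)
    ((measurable_pi_apply i).comp hz) M (fun ω => hM ω i) (hw i)
  have e : (fun ω => dotd (z ω) ((P[w|m]) ω)) =ᵐ[P]
      fun ω => ∑ i, z ω i * (P[fun ω => w ω i|m]) ω := by
    filter_upwards [ae_all_iff.2 fun i => condExp_coord (m := m) P w hw i] with ω hω
    unfold dotd
    exact Finset.sum_congr rfl fun i _ => by rw [← hω i]
  refine ⟨integrable_finsetSum _ fun i _ => (h i).1,
    (integrable_finsetSum _ fun i _ => (h i).2.1).congr e.symm, ?_⟩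
  rw [integral_congr_ae e]
  unfold dotd
  rw [integral_finsetSum _ fun i _ => (h i).1, integral_finsetSum _ fun i _ => (h i).2.1]
  exact Finset.sum_congr rfl fun i _ => (h i).2.2


theorem perturb {Ω : Type} {mΩ : MeasurableSpace Ω} (P : Measure Ω) [IsProbabilityMeasure P]
    {T d : ℕ} (ℱ : Fin (T+1) → MeasurableSpace Ω)
    (hℱ_le : ∀ t, ℱ t ≤ mΩ) (hℱ_mono : Monotone ℱ)
    (K : Fin (T+1) → (Fin d → ℝ) → (Fin d → ℝ) → Ω → EReal)
    (hK_meas : ∀ t, @Measurable (((Fin d → ℝ) × (Fin d → ℝ)) × Ω) EReal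
      (MeasurableSpace.prod inferInstance (ℱ t)) _ (fun p => K t p.1.1 p.1.2 p.2))
    (hK : ∀ t ω, (∀ x u, K t x u ω ≠ ⊥))
    (𝓤 : Submodule ℝ (Ω → Fin (T+1) → Fin d → ℝ))
    (h𝓤dec : DecomposableB P (𝓤 : Set (Ω → Fin (T+1) → Fin d → ℝ)))
    (u x y0 : Ω → Fin (T+1) → Fin d → ℝ) (hu : u ∈ NBolza d ℱ) (hx : x ∈ NBolza d ℱ)
    (hy0 : ∀ t i, Integrable (fun ω => y0 ω t i) P)
    (hy : ∀ t i, Integrable (fun ω => aProj P ℱ y0 ω t i) P)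
    (p : ℝ) (hp : intFB P K x u = (p : EReal))
    (hsub : ∀ h ∈ 𝓤, h ∈ NBolza d ℱ →
      ((p + pairB P h y0 : ℝ) : EReal) ≤ phiB P K ℱ (u + h))
    (t : Fin (T+1)) (α β : Ω → Fin d → ℝ) (κ : Ω → ℝ) (M : ℝ)
    (hα : Measurable[ℱ t] α) (hβ : Measurable[ℱ t] β) (hκ : Measurable[ℱ t] κ)
    (hαM : ∀ ω i, |α ω i| ≤ M) (hβM : ∀ ω i, |β ω i| ≤ M) (hκM : ∀ ω, |κ ω| ≤ M)
    (hKκ : ∀ ω, K t (x ω t + α ω) (deltaX (x ω) t + u ω t + β ω) ω =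
      K t (x ω t) (deltaX (x ω) t + u ω t) ω + (κ ω : EReal)) :
    Integrable κ P ∧ Integrable (fun ω => dotd (condDelta P ℱ (aProj P ℱ y0) t ω) (α ω) +
      dotd (aProj P ℱ y0 ω t) (β ω)) P ∧
    ∫ ω, (dotd (condDelta P ℱ (aProj P ℱ y0) t ω) (α ω) +
      dotd (aProj P ℱ y0 ω t) (β ω)) ∂P ≤ ∫ ω, κ ω ∂P := by
  have hMo : M ≥ 0 ∨ d = 0 := by
    rcases Nat.eq_zero_or_pos d with h | h
    · exact Or.inr h
    · obtain ⟨ω⟩ := P.nonempty_of_neZero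
      exact Or.inl ((abs_nonneg _).trans (hαM ω ⟨0, h⟩))
  let y := aProj P ℱ y0
  have sing : ∀ (γ : Ω → Fin d → ℝ), Measurable[ℱ t] γ →
      (fun ω => (Pi.single t (γ ω) : Fin (T+1) → Fin d → ℝ)) ∈ NBolza d ℱ := by
    intro γ hγ s
    by_cases h : s = t
    · subst h; simpa only [Pi.single_eq_same] using hγ
    · simp only [Pi.single_eq_of_ne h]; exact measurable_const
  have singb : ∀ (γ : Ω → Fin d → ℝ), (∀ ω i, |γ ω i| ≤ M) → ∀ ω s i,
      |(Pi.single t (γ ω) : Fin (T+1) → Fin d → ℝ) s i| ≤ M := by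
    intro γ hγ ω s i
    by_cases h : s = t
    · subst h; simpa only [Pi.single_eq_same] using hγ ω i
    · simp only [Pi.single_eq_of_ne h, Pi.zero_apply, abs_zero]
      rcases hMo with h | h
      · exact h
      · exact absurd i.2 (by omega)
  let z : Ω → Fin (T+1) → Fin d → ℝ := fun ω => Pi.single t (α ω)
  let b : Ω → Fin (T+1) → Fin d → ℝ := fun ω => Pi.single t (β ω)
  have hz : z ∈ NBolza d ℱ := sing α hα
  have hb : b ∈ NBolza d ℱ := sing β hβ
  let h : Ω → Fin (T+1) → Fin d → ℝ := fun ω s => b ω s - deltaX (z ω) s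
  have hha : h ∈ NBolza d ℱ := fun s => Measurable.sub (hb s) (meas_deltaX ℱ hℱ_mono z hz s)
  have hhM : ∀ ω s i, |h ω s i| ≤ 3 * M := by
    intro ω s i
    have b1 := abs_le.1 (singb β hβM ω s i)
    have b2 := abs_le.1 (singb α hαM ω s i)
    simp only [h, deltaX, Pi.sub_apply, z, b]
    split_ifs with h0
    · simp only [Pi.zero_apply]
      rw [abs_le]; constructor <;> linarith
    · have b3 := abs_le.1 (singb α hαM ω
        ⟨(s : ℕ) - 1, Nat.lt_of_le_of_lt (Nat.sub_le _ _) s.isLt⟩ i)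
      rw [abs_le]; constructor <;> linarith
  have hhU : h ∈ 𝓤 := dec_bdd P 𝓤 h𝓤dec h
    (measurable_pi_iff.2 fun s => (hha s).mono (hℱ_le s) le_rfl) (3 * M) hhM
  have hx' : (x + z) ∈ NBolza d ℱ := fun s => Measurable.add (hx s) (hz s)
  -- the value of the perturbed problem
  have hκi : Integrable κ P := Integrable.of_bound
    ((hκ.mono (hℱ_le t) le_rfl).aestronglyMeasurable) M (Filter.Eventually.of_forall hκM)
  obtain ⟨i1, q1⟩ := EE_real (meas_fB ℱ hℱ_le hℱ_mono K hK_meas x u hx hu)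
    (by change intFB P K x u ≠ ⊤; rw [hp]; exact EReal.coe_ne_top _)
    (by change intFB P K x u ≠ ⊥; rw [hp]; exact EReal.coe_ne_bot _)
  have e1 : p = ∫ ω, (fBolza K (x ω) (u ω) ω).toReal ∂P := by
    have := EE_congr_coe i1 q1
    unfold intFB at hp
    rw [hp] at this
    exact_mod_cast this
  have hval : intFB P K (x + z) (u + h) = ((p + ∫ ω, κ ω ∂P : ℝ) : EReal) := by
    rw [e1, ← integral_add i1 hκi]
    refine EE_congr_coe (i1.add hκi) ?_
    filter_upwards [q1] with ω w1
    have : fBolza K ((x + z) ω) ((u + h) ω) ω = fBolza K (x ω) (u ω) ω + (κ ω : EReal) := by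
      unfold fBolza
      rw [← Finset.add_sum_erase _ _ (Finset.mem_univ t),
        ← Finset.add_sum_erase (a := t) _ _ (Finset.mem_univ t)]
      have ed : ∀ s, deltaX ((x + z) ω) s + (u + h) ω s = deltaX (x ω) s + u ω s + b ω s := by
        intro s
        have := deltaX_comb (x ω) (z ω) 1 1 s
        simp only [one_smul] at this
        change deltaX (x ω + z ω) s + (u ω s + (b ω s - deltaX (z ω) s)) = _
        rw [this]; abel
      have h1 : K t ((x + z) ω t) (deltaX ((x + z) ω) t + (u + h) ω t) ω =
          K t (x ω t) (deltaX (x ω) t + u ω t) ω + (κ ω : EReal) := by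
        rw [ed, ← hKκ]
        simp only [Pi.add_apply, z, b, Pi.single_eq_same]
      have h2 : ∀ s ∈ Finset.univ.erase t,
          K s ((x + z) ω s) (deltaX ((x + z) ω) s + (u + h) ω s) ω =
          K s (x ω s) (deltaX (x ω) s + u ω s) ω := by
        intro s hs
        have hst : s ≠ t := Finset.ne_of_mem_erase hs
        rw [ed]
        simp only [Pi.add_apply, z, b, Pi.single_eq_of_ne hst, add_zero]
      rw [h1, Finset.sum_congr rfl h2]
      abel
    rw [this, w1, EReal.toReal_coe, ← EReal.coe_add]
  have hineq := (hsub h hhU hha).trans (iInf₂_le (x + z) hx')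
  rw [hval, EReal.coe_le_coe_iff] at hineq
  -- the pairing
  have hα' := pull_d P (hℱ_le t) α (fun ω => deltaNext (y ω) t) hα M hαM
    (fun i => deltaNext_int P y hy t i)
  have hβ' := pull_d P (hℱ_le t) β (fun ω => y0 ω t) hβ M hβM (fun i => hy0 t i)
  have hp1 : pairB P h y0 = ∫ ω, dotB (h ω) (y ω) ∂P := by
    unfold pairB dotB
    change _ = ∫ ω, ∑ s, dotd (h ω s) ((P[fun ω' => y0 ω' s | ℱ s]) ω) ∂P
    have := fun s => pull_d P (hℱ_le s) (fun ω => h ω s) (fun ω => y0 ω s) (hha s) (3*M)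
      (fun ω i => hhM ω s i) (fun i => hy0 s i)
    rw [integral_finsetSum _ fun s _ => (this s).1, integral_finsetSum _ fun s _ => (this s).2.1]
    exact Finset.sum_congr rfl fun s _ => (this s).2.2
  have hp2 : ∀ ω, dotB (h ω) (y ω) = dotd (β ω) (y ω t) + dotd (α ω) (deltaNext (y ω) t) := by
    intro ω
    have a1 : ∑ s, dotd (b ω s) (y ω s) = dotd (β ω) (y ω t) := by
      rw [Finset.sum_eq_single t]
      · simp only [b, Pi.single_eq_same]
      · intro s _ hs
        simp only [b, Pi.single_eq_of_ne hs]; simp [dotd]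
      · simp
    have a2 : ∑ s, dotd (z ω s) (deltaNext (y ω) s) = dotd (α ω) (deltaNext (y ω) t) := by
      rw [Finset.sum_eq_single t]
      · simp only [z, Pi.single_eq_same]
      · intro s _ hs
        simp only [z, Pi.single_eq_of_ne hs]; simp [dotd]
      · simp
    have a3 := sum_parts (y ω) (z ω)
    unfold dotB
    have a4 : ∀ s, dotd (h ω s) (y ω s) = dotd (b ω s) (y ω s) - dotd (y ω s) (deltaX (z ω) s) := by
      intro s
      simp only [h]
      rw [dotd_comm, dotd_sub_right, dotd_comm (y ω s) (b ω s)]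
    simp only [a4]
    rw [Finset.sum_sub_distrib, a1, a3, a2]
    ring
  simp only [hp2] at hp1
  have i2 : Integrable (fun ω => dotd (β ω) (y ω t)) P := hβ'.2.1
  have hp3 : pairB P h y0 = ∫ ω, dotd (β ω) (y ω t) ∂P +
      ∫ ω, dotd (α ω) (condDelta P ℱ y t ω) ∂P := by
    rw [hp1]
    refine (integral_add i2 hα'.1).trans ?_
    rw [hα'.2.2]
    rfl
  have i3 : Integrable (fun ω => dotd (condDelta P ℱ y t ω) (α ω)) P := by
    simp only [dotd_comm _ (α _)]; exact hα'.2.1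
  have i4 : Integrable (fun ω => dotd (y ω t) (β ω)) P := by
    simp only [dotd_comm _ (β _)]; exact i2
  refine ⟨hκi, i3.add i4, ?_⟩
  refine le_trans (le_of_eq (integral_add i3 i4)) ?_
  simp only [dotd_comm _ (β _), dotd_comm _ (α _)]
  linarith


theorem necess {Ω : Type} {mΩ : MeasurableSpace Ω} (P : Measure Ω) [IsProbabilityMeasure P]
    {T d : ℕ} (ℱ : Fin (T+1) → MeasurableSpace Ω)
    (hℱ_le : ∀ t, ℱ t ≤ mΩ) (hℱ_mono : Monotone ℱ)
    (K : Fin (T+1) → (Fin d → ℝ) → (Fin d → ℝ) → Ω → EReal)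
    (hK_meas : ∀ t, @Measurable (((Fin d → ℝ) × (Fin d → ℝ)) × Ω) EReal
      (MeasurableSpace.prod inferInstance (ℱ t)) _ (fun p => K t p.1.1 p.1.2 p.2))
    (hK : ∀ t ω, (∀ x u, K t x u ω ≠ ⊥))
    (𝓤 : Submodule ℝ (Ω → Fin (T+1) → Fin d → ℝ))
    (h𝓤dec : DecomposableB P (𝓤 : Set (Ω → Fin (T+1) → Fin d → ℝ)))
    (u x y0 : Ω → Fin (T+1) → Fin d → ℝ) (hu : u ∈ NBolza d ℱ) (hx : x ∈ NBolza d ℱ)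
    (hy0 : ∀ t i, Integrable (fun ω => y0 ω t i) P)
    (hy : ∀ t i, Integrable (fun ω => aProj P ℱ y0 ω t i) P)
    (p : ℝ) (hp : intFB P K x u = (p : EReal))
    (hfin : ∀ᵐ ω ∂P, fBolza K (x ω) (u ω) ω ≠ ⊤)
    (hsub : ∀ h ∈ 𝓤, h ∈ NBolza d ℱ →
      ((p + pairB P h y0 : ℝ) : EReal) ≤ phiB P K ℱ (u + h)) (t : Fin (T+1)) :
    ∀ᵐ ω ∂P, ∀ x' u' : Fin d → ℝ,
              K t (x ω t) (deltaX (x ω) t + u ω t) ω +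
                ((dotd (condDelta P ℱ (aProj P ℱ y0) t ω) (x' - x ω t) +
                  dotd (aProj P ℱ y0 ω t) (u' - (deltaX (x ω) t + u ω t)) : ℝ) : EReal) ≤
                K t x' u' ω := by
  by_contra hnot
  have hpos := sel_viol (m := ℱ t) (P.trim (hℱ_le t)) (K t) (hK_meas t) (fun x u ω => hK t ω x u)
    (fun ω => x ω t) (fun ω => deltaX (x ω) t + u ω t) (condDelta P ℱ (aProj P ℱ y0) t)
    (fun ω => aProj P ℱ y0 ω t) (hx t) (Measurable.add (meas_deltaX ℱ hℱ_mono x hx t) (hu t))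
    stronglyMeasurable_condExp.measurable stronglyMeasurable_condExp.measurable (by
      intro h0
      apply hnot
      have h1 := measure_eq_zero_of_trim_eq_zero (hℱ_le t) h0
      have h2 : ∀ᵐ ω ∂P, ω ∉ {ω | ∃ p : (Fin d → ℝ) × (Fin d → ℝ), K t p.1 p.2 ω <
        K t (x ω t) (deltaX (x ω) t + u ω t) ω +
        ((dotd (condDelta P ℱ (aProj P ℱ y0) t ω) (p.1 - x ω t) +
          dotd (aProj P ℱ y0 ω t) (p.2 - (deltaX (x ω) t + u ω t)) : ℝ) : EReal) ∧
          K t (x ω t) (deltaX (x ω) t + u ω t) ω < ⊤} := measure_eq_zero_iff_ae_notMem.1 h1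
      filter_upwards [h2, hfin] with ω a b x' u'
      by_contra! hlt
      have hr := (fB_real K hK (x ω) (u ω) ω b).1 t
      exact a ⟨(x', u'), hlt, by rw [hr]; exact EReal.coe_lt_top _⟩)
  obtain ⟨A, hA, hA0, α, β, κ, M, m1, m2, m3, b1, b2, b3, e, l1, l2⟩ := hpos
  obtain ⟨i1, i2, hle⟩ := perturb P ℱ hℱ_le hℱ_mono K hK_meas hK 𝓤 h𝓤dec u x y0 hu hx hy0 hy p hp
    hsub t α β κ M m1 m2 m3 b1 b2 b3 e
  have h1 : 0 ≤ᵐ[P] fun ω => (dotd (condDelta P ℱ (aProj P ℱ y0) t ω) (α ω) +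
      dotd (aProj P ℱ y0 ω t) (β ω)) - κ ω :=
    Filter.Eventually.of_forall fun ω => sub_nonneg.2 (l1 ω)
  have h2 : ∫ ω, ((dotd (condDelta P ℱ (aProj P ℱ y0) t ω) (α ω) +
      dotd (aProj P ℱ y0 ω t) (β ω)) - κ ω) ∂P = 0 := by
    refine le_antisymm ?_ (integral_nonneg_of_ae h1)
    rw [integral_sub i2 i1]
    linarith
  have h3 := (integral_eq_zero_iff_of_nonneg_ae h1 (i2.sub i1)).1 h2
  apply hA0
  rw [trim_measurableSet_eq _ hA]
  rw [measure_eq_zero_iff_ae_notMem]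
  filter_upwards [h3] with ω hω hωA
  have := l2 ω hωA
  simp only [Pi.zero_apply] at hω
  linarith

end HelperFacts

/-- stochastic Euler–Lagrange and Hamiltonian optimality conditions for the
problem of Bolza. -/
theorem stmt_15
    {Ω : Type} {mΩ : MeasurableSpace Ω} (P : Measure Ω) [IsProbabilityMeasure P]
    {T d : ℕ} (ℱ : Fin (T+1) → MeasurableSpace Ω)
    (hℱ_le : ∀ t, ℱ t ≤ mΩ) (hℱ_mono : Monotone ℱ)
    -- the `K_t` are `B(ℝ^d×ℝ^d)⊗𝓕_t`-measurable convex normal integrands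
    (K : Fin (T+1) → (Fin d → ℝ) → (Fin d → ℝ) → Ω → EReal)
    (hK_meas : ∀ t, @Measurable (((Fin d → ℝ) × (Fin d → ℝ)) × Ω) EReal
      (MeasurableSpace.prod inferInstance (ℱ t)) _ (fun p => K t p.1.1 p.1.2 p.2))
    (hK_proper : ∀ t ω, (∀ x u, K t x u ω ≠ ⊥) ∧ ∃ x u, K t x u ω ≠ ⊤)
    (hK_lsc : ∀ t ω, LowerSemicontinuous
      (fun p : (Fin d → ℝ) × (Fin d → ℝ) => K t p.1 p.2 ω))
    (hK_convex : ∀ (t : Fin (T+1)) (ω : Ω) (a b : ℝ) (x₁ x₂ u₁ u₂ : Fin d → ℝ),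
      0 < a → 0 < b → a + b = 1 →
      K t (a • x₁ + b • x₂) (a • u₁ + b • u₂) ω ≤
        (a : EReal) * K t x₁ u₁ ω + (b : EReal) * K t x₂ u₂ ω)
    -- `𝓤` and `𝓨` are decomposable subspaces in separating duality
    (𝓤 𝓨 : Submodule ℝ (Ω → Fin (T+1) → Fin d → ℝ))
    (h𝓤meas : ∀ u ∈ 𝓤, Measurable u) (h𝓨meas : ∀ y ∈ 𝓨, Measurable y)
    (h𝓤dec : DecomposableB P (𝓤 : Set (Ω → Fin (T+1) → Fin d → ℝ))) (h𝓨dec : DecomposableB P (𝓨 : Set (Ω → Fin (T+1) → Fin d → ℝ)))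
    (hpair : ∀ u ∈ 𝓤, ∀ y ∈ 𝓨, Integrable (fun ω => dotB (u ω) (y ω)) P)
    (hsep𝓤 : ∀ u ∈ 𝓤, (∀ y ∈ 𝓨, pairB P u y = 0) → u =ᵐ[P] (fun _ => 0))
    (hsep𝓨 : ∀ y ∈ 𝓨, (∀ u ∈ 𝓤, pairB P u y = 0) → y =ᵐ[P] (fun _ => 0))
    -- assumption (i): the relative-interior domain condition
    (hdom : ∀ x ∈ NBolzaInf d ℱ P,
      (∀ t, ∀ᵐ ω ∂P, x ω t ∈
        closure {z : Fin d → ℝ | ∃ u : Fin d → ℝ, K t z u ω < ⊤}) →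
      ∃ xbar ∈ NBolzaInf d ℱ P,
        (∀ t, ∀ᵐ ω ∂P, xbar ω t ∈
          intrinsicInterior ℝ {z : Fin d → ℝ | ∃ u : Fin d → ℝ, K t z u ω < ⊤}) ∧
        ∀ lam : ℝ, 0 < lam → lam ≤ 1 → ((1 - lam) • x + lam • xbar) ∈ dom1B P K ℱ (𝓤 : Set (Ω → Fin (T+1) → Fin d → ℝ)))
    -- assumption (ii): adapted projections stay in `𝓤` and `𝓨`
    (hproj𝓤 : ∀ u ∈ 𝓤, aProj P ℱ u ∈ 𝓤)
    (hproj𝓨 : ∀ y ∈ 𝓨, aProj P ℱ y ∈ 𝓨)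
    -- `𝓤` carries a barreled locally convex topology compatible with the pairing
    (τ : TopologicalSpace ↥𝓤)
    (hτ_grp : @IsTopologicalAddGroup ↥𝓤 τ _)
    (hτ_smul : @ContinuousSMul ℝ ↥𝓤 _ _ τ)
    (hτ_lcs : @LocallyConvexSpace ℝ ↥𝓤 _ _ _ _ τ)
    (hτ_barrel : ∀ S : Set ↥𝓤, @IsClosed ↥𝓤 τ S → Convex ℝ S → Absorbent ℝ S →
      S ∈ @nhds ↥𝓤 τ 0)
    (hτ_compat : ∀ g : ↥𝓤 →ₗ[ℝ] ℝ, (@Continuous ↥𝓤 ℝ τ _ g) ↔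
      ∃ y ∈ 𝓨, ∀ u : ↥𝓤, g u = pairB P (u : Ω → Fin (T+1) → Fin d → ℝ) y)
    -- `u ↦ Ef(x,u)` is closed for every `x ∈ 𝓝`
    (hclosed : ∀ x ∈ NBolza d ℱ, ClosedFnB P (𝓤 : Set (Ω → Fin (T+1) → Fin d → ℝ)) (𝓨 : Set (Ω → Fin (T+1) → Fin d → ℝ)) (fun u => intFB P K x u))
    -- `φ` is proper
    (hφ_proper : (∀ u ∈ 𝓤, phiB P K ℱ u ≠ ⊥) ∧ ∃ u ∈ 𝓤, phiB P K ℱ u ≠ ⊤)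
    -- `θ` is a convex normal integrand with `Eθ` finite on `𝓤` and `Eθ*` proper on `𝓨`
    (θ : (Fin (T+1) → Fin d → ℝ) → Ω → EReal)
    (hθ_meas : Measurable (fun p : (Fin (T+1) → Fin d → ℝ) × Ω => θ p.1 p.2))
    (hθ_proper : ∀ ω, (∀ z, θ z ω ≠ ⊥) ∧ ∃ z, θ z ω ≠ ⊤)
    (hθ_lsc : ∀ ω, LowerSemicontinuous (fun z => θ z ω))
    (hθ_convex : ∀ (ω : Ω) (a b : ℝ) (z₁ z₂ : Fin (T+1) → Fin d → ℝ),
      0 < a → 0 < b → a + b = 1 →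
      θ (a • z₁ + b • z₂) ω ≤ (a : EReal) * θ z₁ ω + (b : EReal) * θ z₂ ω)
    (hEθ_fin : ∀ u ∈ 𝓤, ∃ r : ℝ, EE P (fun ω => θ (u ω) ω) = (r : EReal))
    (hEθs_proper :
      (∀ y ∈ 𝓨, EE P (fun ω =>
        ⨆ z : Fin (T+1) → Fin d → ℝ, (((dotB z (y ω) : ℝ) : EReal) - θ z ω)) ≠ ⊥) ∧
      ∃ y ∈ 𝓨, EE P (fun ω =>
        ⨆ z : Fin (T+1) → Fin d → ℝ, (((dotB z (y ω) : ℝ) : EReal) - θ z ω)) ≠ ⊤)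
    -- the growth condition on adapted parameters
    (hgrowth : ∀ u ∈ 𝓤, (∀ t, Measurable[ℱ t] (fun ω => u ω t)) →
      ∃ x ∈ NBolza d ℱ, ∀ᵐ ω ∂P, fBolza K (x ω) (u ω) ω ≤ θ (u ω) ω)
    -- the given adapted parameter `u ∈ 𝓤∩𝓝`
    (u : Ω → Fin (T+1) → Fin d → ℝ) (hu : u ∈ 𝓤)
    (hu_adapted : ∀ t, Measurable[ℱ t] (fun ω => u ω t)) :
    ∀ x ∈ NBolza d ℱ,
      -- Euler--Lagrange form: `(E_tΔy_{t+1}, y_t) ∈ ∂K_t(x_t, Δx_t+u_t)` a.s. for all `t`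
      (intFB P K x u = phiB P K ℱ u ↔
        (intFB P K x u < ⊤ ∧
          ∃ y, y ∈ 𝓨 ∧ (∀ t, Measurable[ℱ t] (fun ω => y ω t)) ∧
            ∀ t, ∀ᵐ ω ∂P, ∀ x' u' : Fin d → ℝ,
              K t (x ω t) (deltaX (x ω) t + u ω t) ω +
                ((dotd (condDelta P ℱ y t ω) (x' - x ω t) +
                  dotd (y ω t) (u' - (deltaX (x ω) t + u ω t)) : ℝ) : EReal) ≤
                K t x' u' ω)) ∧
      -- Hamiltonian form: `E_tΔy_{t+1} ∈ ∂ₓH_t(x_t,y_t)`, `u_t+Δx_t ∈ ∂_y[−H_t](x_t,y_t)`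
      (intFB P K x u = phiB P K ℱ u ↔
        (intFB P K x u < ⊤ ∧
          ∃ y, y ∈ 𝓨 ∧ (∀ t, Measurable[ℱ t] (fun ω => y ω t)) ∧
            ∀ t, ∀ᵐ ω ∂P,
              (∀ x' : Fin d → ℝ,
                HamB K t (x ω t) (y ω t) ω +
                  ((dotd (condDelta P ℱ y t ω) (x' - x ω t) : ℝ) : EReal) ≤
                  HamB K t x' (y ω t) ω) ∧
              (∀ y' : Fin d → ℝ,
                -(HamB K t (x ω t) (y ω t) ω) +
                  ((dotd (u ω t + deltaX (x ω) t) (y' - y ω t) : ℝ) : EReal) ≤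
                  -(HamB K t (x ω t) y' ω)))) := by
  have hK : ∀ t ω, (∀ x u, K t x u ω ≠ ⊥) := fun t ω => (hK_proper t ω).1
  have dcomm : ∀ a b : Fin (T+1) → Fin d → ℝ, dotB a b = dotB b a := fun a b => by
    unfold dotB
    exact Finset.sum_congr rfl fun t _ => dotd_comm _ _
  have hcU : ∀ u ∈ 𝓤, ∀ t i, Integrable (fun ω => u ω t i) P := fun u hu t i =>
    coord_int P 𝓨 h𝓨dec u (h𝓤meas u hu)
      (fun y hy => by simp only [dcomm (y _) (u _)]; exact hpair u hu y hy) t i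
  have hcY : ∀ y ∈ 𝓨, ∀ t i, Integrable (fun ω => y ω t i) P := fun y hy t i =>
    coord_int P 𝓤 h𝓤dec y (h𝓨meas y hy) (fun u hu => hpair u hu y hy) t i
  obtain ⟨yb, hyb, hEs⟩ := hEθs_proper.2
  obtain ⟨q, hq, hqc, c, hc⟩ := theta_nhds P 𝓤 𝓨 h𝓤meas h𝓨meas h𝓨dec hpair hcU (τ := τ)
    hτ_barrel hτ_compat θ hθ_meas hθ_lsc hθ_convex hEθ_fin yb hyb hEs u hu
  obtain ⟨p, hp, y0, hy0, hsub⟩ := phi_subgrad P ℱ hℱ_le hℱ_mono K hK_meas hK hK_convex 𝓤 𝓨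
    (τ := τ) hτ_compat hφ_proper.1 θ hgrowth u hu hu_adapted q hq hqc c hc
  intro x hx
  have hge : ∀ x' ∈ NBolza d ℱ, phiB P K ℱ u ≤ intFB P K x' u := fun x' hx' => iInf₂_le x' hx'
  have hbot : ∀ x' ∈ NBolza d ℱ, intFB P K x' u ≠ ⊥ := fun x' hx' h => by
    have := hge x' hx'
    rw [hp, h] at this
    simp at this
  have hreal : intFB P K x u < ⊤ → ∀ᵐ ω ∂P, fBolza K (x ω) (u ω) ω ≠ ⊤ := fun h => by
    filter_upwards [(EE_real (meas_fB ℱ hℱ_le hℱ_mono K hK_meas x u hx hu_adapted) h.ne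
      (hbot x hx)).2] with ω hω
    rw [hω]
    exact EReal.coe_ne_top _
  have main : (intFB P K x u = phiB P K ℱ u ↔
        (intFB P K x u < ⊤ ∧
          ∃ y, y ∈ 𝓨 ∧ (∀ t, Measurable[ℱ t] (fun ω => y ω t)) ∧
            ∀ t, ∀ᵐ ω ∂P, ∀ x' u' : Fin d → ℝ,
              K t (x ω t) (deltaX (x ω) t + u ω t) ω +
                ((dotd (condDelta P ℱ y t ω) (x' - x ω t) +
                  dotd (y ω t) (u' - (deltaX (x ω) t + u ω t)) : ℝ) : EReal) ≤
                K t x' u' ω)) := by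
    constructor
    · intro h
      have hlt : intFB P K x u < ⊤ := by rw [h, hp]; exact EReal.coe_lt_top _
      refine ⟨hlt, aProj P ℱ y0, hproj𝓨 y0 hy0,
        fun t => stronglyMeasurable_condExp.measurable, fun t => ?_⟩
      exact necess P ℱ hℱ_le hℱ_mono K hK_meas hK 𝓤 h𝓤dec u x y0 hu_adapted hx (hcY y0 hy0)
        (hcY _ (hproj𝓨 y0 hy0)) p (h.trans hp) (hreal hlt) hsub t
    · rintro ⟨hlt, y, hy, -, hEL⟩
      refine le_antisymm (le_iInf₂ fun x' hx' => ?_) (hge x hx)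
      by_cases ht : intFB P K x' u = ⊤
      · rw [ht]; exact le_top
      · exact suff_main P ℱ hℱ_le hℱ_mono K hK_meas hK u x x' y hu_adapted hx hx' (hcY y hy)
          hlt.ne (hbot x hx) ht (hbot x' hx') hEL
  refine ⟨main, main.trans ?_⟩
  refine and_congr_right fun hlt => exists_congr fun y => and_congr_right fun _ =>
    and_congr_right fun _ => forall_congr' fun t => ?_
  refine Filter.eventually_congr ?_
  filter_upwards [hreal hlt] with ω hω
  have hr := (fB_real K hK (x ω) (u ω) ω hω).1 t
  have := ham_iff (fun x' u' => K t x' u' ω) (fun x' u' => hK t ω x' u') (hK_lsc t ω)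
    (fun a b x₁ x₂ u₁ u₂ ha hb hab => hK_convex t ω a b x₁ x₂ u₁ u₂ ha hb hab)
    (x ω t) (deltaX (x ω) t + u ω t) (condDelta P ℱ y t ω) (y ω t) _ hr
  rw [add_comm (u ω t) (deltaX (x ω) t)]
  exact this
end
end
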